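/- Let M ≥ 3 be an integer and A = ℤ/2 × ℤ/2M. Then the ℚ-vector space M₂⁻(A) ⊗ ℚ has dimension 1 − φ(M) − φ(2M)/2 + (M²/3)·∏_{p | 2M}(1 − p⁻²), and the torsion subgroup of M₂⁻(A) is isomorphic to (ℤ/2)^{2φ(M) + φ(2M) − 1}. Here φ is Euler's totient function and the product runs over the distinct primes p dividing 2M. Moreover, for an odd prime p and A = ℤ/p × ℤ/p, one has dim_ℚ(M₂(A) ⊗ ℚ) = (p−1)(p³ + 6p² − p + 6)/24 and dim_ℚ(M₂⁻(A) ⊗ ℚ) = (p−1)(p³ − p + 12)/24; in particular dim_ℚ(M₂(A) ⊗ ℚ) − dim_ℚ(M₂⁻(A) ⊗ ℚ) = (p+1)(p−1)²/4. -/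

import Mathlib

open FreeAbelianGroup AddSubgroup

/-- The set of `n`-tuples of elements of `A` which generate `A`. -/
def GenTuple (n : ℕ) (A : Type) [AddCommGroup A] : Type :=
  {b : Fin n → A // AddSubgroup.closure (Set.range b) = ⊤}

namespace KPT

variable (n : ℕ) (A : Type) [AddCommGroup A]

/-- Reordering relation (O). -/
def relO : Set (FreeAbelianGroup (GenTuple n A)) :=
  {x | ∃ (β β' : GenTuple n A) (σ : Equiv.Perm (Fin n)),
    β'.1 = β.1 ∘ σ ∧ x = of β - of β'}

/-- Motivic blowup relation (M). -/
def relM : Set (FreeAbelianGroup (GenTuple n A)) :=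
  {x | ∃ (hn : 2 ≤ n) (β β₁ β₂ : GenTuple n A),
    β₁.1 = Function.update β.1 ⟨0, by omega⟩
      (β.1 ⟨0, by omega⟩ - β.1 ⟨1, by omega⟩) ∧
    β₂.1 = Function.update β.1 ⟨1, by omega⟩
      (β.1 ⟨1, by omega⟩ - β.1 ⟨0, by omega⟩) ∧
    x = of β - of β₁ - of β₂}

/-- Anti-symmetry relation (A). -/
def relA : Set (FreeAbelianGroup (GenTuple n A)) :=
  {x | ∃ (hn : 1 ≤ n) (β β' : GenTuple n A),
    β'.1 = Function.update β.1 ⟨0, by omega⟩ (-(β.1 ⟨0, by omega⟩)) ∧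
    x = of β + of β'}

/-- The Kontsevich–Pestun–Tschinkel group `M_n(A)`. -/
def Mn : Type :=
  FreeAbelianGroup (GenTuple n A) ⧸ AddSubgroup.closure (relO n A ∪ relM n A)

instance : AddCommGroup (Mn n A) := QuotientAddGroup.Quotient.addCommGroup _

/-- The group `M_n^-(A)`. -/
def MnMinus : Type :=
  FreeAbelianGroup (GenTuple n A) ⧸
    AddSubgroup.closure (relO n A ∪ relM n A ∪ relA n A)

instance : AddCommGroup (MnMinus n A) := QuotientAddGroup.Quotient.addCommGroup _

/-- The symbol `⟨b₁,…,b_n⟩ ∈ M_n(A)`. -/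
def symb (β : GenTuple n A) : Mn n A := QuotientAddGroup.mk (of β)

/-- The symbol `⟨b₁,…,b_n⟩⁻ ∈ M_n⁻(A)`. -/
def symbm (β : GenTuple n A) : MnMinus n A := QuotientAddGroup.mk (of β)

/-- The natural surjection `M_n(A) → M_n⁻(A)`. -/
def toMinus : Mn n A →+ MnMinus n A :=
  QuotientAddGroup.map _ _ (AddMonoidHom.id _)
    (by
      intro x hx
      simp only [AddSubgroup.mem_comap, AddMonoidHom.id_apply]
      exact AddSubgroup.closure_mono (Set.subset_union_left) hx)

/-- The kernel `K_n(A)` of `M_n(A) → M_n⁻(A)`. -/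
def Kn : AddSubgroup (Mn n A) := (toMinus n A).ker

end KPT

namespace KPT

/-- Ordered pairs of elements which generate `A`. -/
def Gen (A : Type) [AddCommGroup A] : Type :=
  {x : A × A // AddSubgroup.closure {x.1, x.2} = ⊤}

namespace Gen

variable {A : Type} [AddCommGroup A]

/-- The first entry of a generating pair. -/
abbrev fst (x : Gen A) : A := x.1.1

/-- The second entry of a generating pair. -/
abbrev snd (x : Gen A) : A := x.1.2

@[ext]
theorem ext {x y : Gen A} (h₁ : x.fst = y.fst) (h₂ : x.snd = y.snd) : x = y :=
  Subtype.ext (Prod.ext h₁ h₂)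

theorem closure_eq_top_of_combination {u v u' v' : A} (h : AddSubgroup.closure {u, v} = ⊤)
    {a b c d : ℤ} (hu : a • u' + b • v' = u) (hv : c • u' + d • v' = v) :
    AddSubgroup.closure {u', v'} = ⊤ := by
  rw [eq_top_iff, ← h, AddSubgroup.closure_le]
  rintro w (rfl | rfl)
  · exact AddSubgroup.mem_closure_pair.2 ⟨a, b, hu⟩
  · exact AddSubgroup.mem_closure_pair.2 ⟨c, d, hv⟩

theorem exists_combination (x : Gen A) (w : A) : ∃ m n : ℤ, m • x.fst + n • x.snd = w :=
  AddSubgroup.mem_closure_pair.1 (x.2 ▸ AddSubgroup.mem_top w)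

open Matrix in
instance : MulAction (GL (Fin 2) ℤ) (Gen A) where
  smul g x := ⟨(g 0 0 • x.fst + g 0 1 • x.snd, g 1 0 • x.fst + g 1 1 • x.snd), by
    have h : (g⁻¹ : GL (Fin 2) ℤ).1 * g.1 = 1 := by simp
    have h00 := congrFun (congrFun h 0) 0
    have h01 := congrFun (congrFun h 0) 1
    have h10 := congrFun (congrFun h 1) 0
    have h11 := congrFun (congrFun h 1) 1
    simp only [Matrix.mul_apply, Fin.sum_univ_two, Matrix.one_apply, Fin.isValue,
      ↓reduceIte, one_ne_zero, zero_ne_one] at h00 h01 h10 h11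
    refine closure_eq_top_of_combination x.2 (a := (g⁻¹).1 0 0) (b := (g⁻¹).1 0 1)
      (c := (g⁻¹).1 1 0) (d := (g⁻¹).1 1 1) ?_ ?_
    · linear_combination (norm := module) h00 • x.fst + h01 • x.snd
    · linear_combination (norm := module) h10 • x.fst + h11 • x.snd⟩
  one_smul x := by
    apply ext
    · change (1 : ℤ) • x.fst + (0 : ℤ) • x.snd = x.fst
      module
    · change (0 : ℤ) • x.fst + (1 : ℤ) • x.snd = x.snd
      module
  mul_smul g h x := by
    apply ext
    · change (g.1 * h.1) 0 0 • x.fst + (g.1 * h.1) 0 1 • x.snd =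
        g.1 0 0 • (h.1 0 0 • x.fst + h.1 0 1 • x.snd) +
          g.1 0 1 • (h.1 1 0 • x.fst + h.1 1 1 • x.snd)
      simp only [Matrix.mul_apply, Fin.sum_univ_two]
      module
    · change (g.1 * h.1) 1 0 • x.fst + (g.1 * h.1) 1 1 • x.snd =
        g.1 1 0 • (h.1 0 0 • x.fst + h.1 0 1 • x.snd) +
          g.1 1 1 • (h.1 1 0 • x.fst + h.1 1 1 • x.snd)
      simp only [Matrix.mul_apply, Fin.sum_univ_two]
      module

/-- The pair `(b, a)`. -/
def swap (x : Gen A) : Gen A :=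
  ⟨(x.snd, x.fst), closure_eq_top_of_combination x.2 (a := 0) (b := 1) (c := 1) (d := 0)
    (by module) (by module)⟩

/-- The pair `(-a, b)`. -/
def flip (x : Gen A) : Gen A :=
  ⟨(-x.fst, x.snd), closure_eq_top_of_combination x.2 (a := -1) (b := 0) (c := 0) (d := 1)
    (by module) (by module)⟩

/-- The pair `(-a, -b)`. -/
def neg (x : Gen A) : Gen A :=
  ⟨(-x.fst, -x.snd), closure_eq_top_of_combination x.2 (a := -1) (b := 0) (c := 0) (d := -1)
    (by module) (by module)⟩

/-- The pair `(b, -a - b)`; it permutes cyclically the triple `(a, b, -a - b)`. -/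
def rot (x : Gen A) : Gen A :=
  ⟨(x.snd, -x.fst - x.snd), closure_eq_top_of_combination x.2 (a := -1) (b := -1) (c := 1) (d := 0)
    (by module) (by module)⟩

@[simp] theorem fst_swap (x : Gen A) : x.swap.fst = x.snd := rfl
@[simp] theorem snd_swap (x : Gen A) : x.swap.snd = x.fst := rfl
@[simp] theorem fst_flip (x : Gen A) : x.flip.fst = -x.fst := rfl
@[simp] theorem snd_flip (x : Gen A) : x.flip.snd = x.snd := rfl
@[simp] theorem fst_neg (x : Gen A) : x.neg.fst = -x.fst := rfl
@[simp] theorem snd_neg (x : Gen A) : x.neg.snd = -x.snd := rfl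
@[simp] theorem fst_rot (x : Gen A) : x.rot.fst = x.snd := rfl
@[simp] theorem snd_rot (x : Gen A) : x.rot.snd = -x.fst - x.snd := rfl

@[simp] theorem swap_swap (x : Gen A) : x.swap.swap = x := rfl
@[simp] theorem flip_flip (x : Gen A) : x.flip.flip = x := by ext <;> simp
@[simp] theorem neg_neg (x : Gen A) : x.neg.neg = x := by ext <;> simp
theorem swap_neg (x : Gen A) : x.neg.swap = x.swap.neg := rfl
@[simp] theorem rot_rot_rot (x : Gen A) : x.rot.rot.rot = x := by ext <;> simp <;> abel
theorem rot_neg (x : Gen A) : x.neg.rot = x.rot.neg := by ext <;> simp; abel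
theorem rot_swap (x : Gen A) : x.swap.rot = x.rot.rot.swap := by ext <;> simp <;> abel
theorem flip_neg (x : Gen A) : x.neg.flip = x.flip.neg := rfl
theorem flip_swap_flip_swap (x : Gen A) : x.swap.flip.swap.flip = x.neg := rfl

section Dihedral

open DihedralGroup Matrix

/-- The dihedral group of order 12, as the stabilizer of the triangle with edges
`(a, b)`, `(b, -a - b)`, `(-a - b, a)`. -/
def triangleHom : DihedralGroup 6 →* GL (Fin 2) ℤ :=
  MonoidHom.toHomUnits
    { toFun := fun g => match g with
        | r i => (![!![1, 0; 0, 1], !![1, 1; -1, 0], !![0, 1; -1, -1], !![-1, 0; 0, -1],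
            !![-1, -1; 1, 0], !![0, -1; 1, 1]] : Fin 6 → Matrix (Fin 2) (Fin 2) ℤ) i
        | sr i => (![!![0, 1; 1, 0], !![-1, 0; 1, 1], !![-1, -1; 0, 1], !![0, -1; -1, 0],
            !![1, 0; -1, -1], !![1, 1; 0, -1]] : Fin 6 → Matrix (Fin 2) (Fin 2) ℤ) i
      map_one' := by decide
      map_mul' := by decide }

/-- The dihedral group of order 8, as the group of signed permutations of a pair. -/
def edgeHom : DihedralGroup 4 →* GL (Fin 2) ℤ :=
  MonoidHom.toHomUnits
    { toFun := fun g => match g with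
        | r i => (![!![1, 0; 0, 1], !![0, -1; 1, 0], !![-1, 0; 0, -1], !![0, 1; -1, 0]] :
            Fin 4 → Matrix (Fin 2) (Fin 2) ℤ) i
        | sr i => (![!![0, 1; 1, 0], !![1, 0; 0, -1], !![0, -1; -1, 0], !![-1, 0; 0, 1]] :
            Fin 4 → Matrix (Fin 2) (Fin 2) ℤ) i
      map_one' := by decide
      map_mul' := by decide }

instance : MulAction (DihedralGroup 6) (Gen A) := MulAction.compHom _ triangleHom

instance : MulAction (DihedralGroup 4) (Gen A) := MulAction.compHom _ edgeHom

theorem triangle_ext {g : DihedralGroup 6} {x y : Gen A}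
    (h₁ : (triangleHom g).1 0 0 • x.fst + (triangleHom g).1 0 1 • x.snd = y.fst)
    (h₂ : (triangleHom g).1 1 0 • x.fst + (triangleHom g).1 1 1 • x.snd = y.snd) :
    g • x = y := ext h₁ h₂

theorem edge_ext {g : DihedralGroup 4} {x y : Gen A}
    (h₁ : (edgeHom g).1 0 0 • x.fst + (edgeHom g).1 0 1 • x.snd = y.fst)
    (h₂ : (edgeHom g).1 1 0 • x.fst + (edgeHom g).1 1 1 • x.snd = y.snd) :
    g • x = y := ext h₁ h₂

theorem triangle_r_one (x : Gen A) : (r 1 : DihedralGroup 6) • x = x.rot.rot.neg := by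
  apply triangle_ext
  · change (1 : ℤ) • x.fst + (1 : ℤ) • x.snd = - (-x.fst - x.snd)
    module
  · change (-1 : ℤ) • x.fst + (0 : ℤ) • x.snd = - (-x.snd - (-x.fst - x.snd))
    module

theorem triangle_sr_zero (x : Gen A) : (sr 0 : DihedralGroup 6) • x = x.swap := by
  apply triangle_ext
  · change (0 : ℤ) • x.fst + (1 : ℤ) • x.snd = x.snd
    module
  · change (1 : ℤ) • x.fst + (0 : ℤ) • x.snd = x.fst
    module

theorem edge_r_one (x : Gen A) : (r 1 : DihedralGroup 4) • x = x.swap.flip := by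
  apply edge_ext
  · change (0 : ℤ) • x.fst + (-1 : ℤ) • x.snd = -x.snd
    module
  · change (1 : ℤ) • x.fst + (0 : ℤ) • x.snd = x.fst
    module

theorem edge_sr_zero (x : Gen A) : (sr 0 : DihedralGroup 4) • x = x.swap := by
  apply edge_ext
  · change (0 : ℤ) • x.fst + (1 : ℤ) • x.snd = x.snd
    module
  · change (1 : ℤ) • x.fst + (0 : ℤ) • x.snd = x.fst
    module

theorem edge_sr_three (x : Gen A) : (sr 3 : DihedralGroup 4) • x = x.flip := by
  apply edge_ext
  · change (-1 : ℤ) • x.fst + (0 : ℤ) • x.snd = -x.fst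
    module
  · change (0 : ℤ) • x.fst + (1 : ℤ) • x.snd = x.snd
    module

theorem dihedral_rel {n : ℕ} [NeZero n] {X : Type} [MulAction (DihedralGroup n) X]
    {R : X → X → Prop} (hR : Equivalence R) (hr : ∀ x, R x ((r 1 : DihedralGroup n) • x))
    (hs : ∀ x, R x ((sr 0 : DihedralGroup n) • x)) (g : DihedralGroup n) (x : X) :
    R x (g • x) := by
  have hpow (k : ℕ) (x : X) : R x ((r 1 : DihedralGroup n) ^ k • x) := by
    induction k generalizing x with
    | zero => simpa using hR.refl x
    | succ k ih => rw [pow_succ', mul_smul]; exact hR.trans (ih x) (hr _)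
  have hrot (i : ZMod n) (x : X) : R x (r i • x) := by
    have := hpow i.val x
    rwa [r_pow, one_mul, ZMod.natCast_zmod_val] at this
  rcases g with i | i
  · exact hrot i x
  · have : (sr i : DihedralGroup n) = sr 0 * r i := by simp
    rw [this, mul_smul]
    exact hR.trans (hrot i x) (hs _)

end Dihedral

end Gen
end KPT

namespace KPT

/-- No entry of a generating pair is a multiple of the other one, and they are not both killed
by two. -/
def Nondegenerate (A : Type) [AddCommGroup A] : Prop :=
  ∀ x : Gen A, (∀ k : ℤ, x.snd ≠ k • x.fst) ∧ ¬ (x.fst + x.fst = 0 ∧ x.snd + x.snd = 0)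

section Free

open DihedralGroup Gen

variable {A : Type} [AddCommGroup A]

theorem Nondegenerate.snd_ne (hA : Nondegenerate A) (x : Gen A) (k : ℤ) :
    x.snd ≠ k • x.fst := (hA x).1 k

theorem Nondegenerate.fst_ne (hA : Nondegenerate A) (x : Gen A) (k : ℤ) :
    x.fst ≠ k • x.snd := (hA x.swap).1 k

theorem Nondegenerate.triangle_smul_ne (hA : Nondegenerate A) {g : DihedralGroup 6} (hg : g ≠ 1)
    (x : Gen A) : g • x ≠ x := by
  intro h
  have h₁ := congrArg fst h
  have h₂ := congrArg snd h
  rcases g with i | i <;> fin_cases i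
  · exact hg rfl
  · change (1 : ℤ) • x.fst + (1 : ℤ) • x.snd = x.fst at h₁
    exact hA.snd_ne x 0 (by linear_combination (norm := module) h₁)
  · change (0 : ℤ) • x.fst + (1 : ℤ) • x.snd = x.fst at h₁
    exact hA.snd_ne x 1 (by linear_combination (norm := module) h₁)
  · change (-1 : ℤ) • x.fst + (0 : ℤ) • x.snd = x.fst at h₁
    change (0 : ℤ) • x.fst + (-1 : ℤ) • x.snd = x.snd at h₂
    exact (hA x).2 ⟨by linear_combination (norm := module) -h₁,
      by linear_combination (norm := module) -h₂⟩
  · change (1 : ℤ) • x.fst + (0 : ℤ) • x.snd = x.snd at h₂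
    exact hA.snd_ne x 1 (by linear_combination (norm := module) -h₂)
  · change (1 : ℤ) • x.fst + (1 : ℤ) • x.snd = x.snd at h₂
    exact hA.fst_ne x 0 (by linear_combination (norm := module) h₂)
  · change (0 : ℤ) • x.fst + (1 : ℤ) • x.snd = x.fst at h₁
    exact hA.snd_ne x 1 (by linear_combination (norm := module) h₁)
  · change (1 : ℤ) • x.fst + (1 : ℤ) • x.snd = x.snd at h₂
    exact hA.fst_ne x 0 (by linear_combination (norm := module) h₂)
  · change (-1 : ℤ) • x.fst + (-1 : ℤ) • x.snd = x.fst at h₁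
    exact hA.snd_ne x (-2) (by linear_combination (norm := module) -h₁)
  · change (0 : ℤ) • x.fst + (-1 : ℤ) • x.snd = x.fst at h₁
    exact hA.snd_ne x (-1) (by linear_combination (norm := module) -h₁)
  · change (-1 : ℤ) • x.fst + (-1 : ℤ) • x.snd = x.snd at h₂
    exact hA.fst_ne x (-2) (by linear_combination (norm := module) -h₂)
  · change (1 : ℤ) • x.fst + (1 : ℤ) • x.snd = x.fst at h₁
    exact hA.snd_ne x 0 (by linear_combination (norm := module) h₁)

theorem Nondegenerate.edge_smul_eq (hA : Nondegenerate A) {g : DihedralGroup 4} (hg : g ≠ 1)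
    {x : Gen A} (h : g • x = x) :
    (g = sr 1 ∧ x.snd + x.snd = 0) ∨ (g = sr 3 ∧ x.fst + x.fst = 0) := by
  have h₁ := congrArg fst h
  have h₂ := congrArg snd h
  rcases g with i | i <;> fin_cases i
  · exact absurd rfl hg
  · change (0 : ℤ) • x.fst + (-1 : ℤ) • x.snd = x.fst at h₁
    exact absurd (by linear_combination (norm := module) -h₁) (hA.snd_ne x (-1))
  · change (-1 : ℤ) • x.fst + (0 : ℤ) • x.snd = x.fst at h₁
    change (0 : ℤ) • x.fst + (-1 : ℤ) • x.snd = x.snd at h₂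
    exact absurd ⟨by linear_combination (norm := module) -h₁,
      by linear_combination (norm := module) -h₂⟩ (hA x).2
  · change (0 : ℤ) • x.fst + (1 : ℤ) • x.snd = x.fst at h₁
    exact absurd (by linear_combination (norm := module) h₁) (hA.snd_ne x 1)
  · change (0 : ℤ) • x.fst + (1 : ℤ) • x.snd = x.fst at h₁
    exact absurd (by linear_combination (norm := module) h₁) (hA.snd_ne x 1)
  · change (0 : ℤ) • x.fst + (-1 : ℤ) • x.snd = x.snd at h₂
    exact .inl ⟨rfl, by linear_combination (norm := module) -h₂⟩
  · change (0 : ℤ) • x.fst + (-1 : ℤ) • x.snd = x.fst at h₁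
    exact absurd (by linear_combination (norm := module) -h₁) (hA.snd_ne x (-1))
  · change (-1 : ℤ) • x.fst + (0 : ℤ) • x.snd = x.fst at h₁
    exact .inr ⟨rfl, by linear_combination (norm := module) -h₁⟩

end Free

section Count

theorem card_eq_card_orbits_mul_of_free {G X : Type} [Group G] [MulAction G X] [Finite G]
    [Finite X] (h : ∀ g : G, g ≠ 1 → ∀ x : X, g • x ≠ x) :
    Nat.card X = Nat.card (MulAction.orbitRel.Quotient G X) * Nat.card G := by
  classical
  have := Fintype.ofFinite G
  have := Fintype.ofFinite X
  have := Fintype.ofFinite (MulAction.orbitRel.Quotient G X)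
  have := MulAction.sum_card_fixedBy_eq_card_orbits_mul_card_group G X
  rw [Finset.sum_eq_single 1] at this
  · simp only [Nat.card_eq_fintype_card]
    rw [← this, ← Nat.card_eq_fintype_card, ← Nat.card_eq_fintype_card,
      MulAction.fixedBy_one_eq_univ, Nat.card_univ]
  · intro g _ hg
    rw [Fintype.card_eq_zero_iff]
    exact ⟨fun x ↦ h g hg x.1 x.2⟩
  · simp

open DihedralGroup Gen

variable {A : Type} [AddCommGroup A]

instance [Finite A] : Finite (Gen A) := inferInstanceAs (Finite {_x : A × A // _})

instance (n : ℕ) [NeZero n] : Finite (DihedralGroup n) := inferInstance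

/-- Equivalence classes of triangles. -/
abbrev Triangles (A : Type) [AddCommGroup A] : Type :=
  MulAction.orbitRel.Quotient (DihedralGroup 6) (Gen A)

/-- Equivalence classes of edges. -/
abbrev Edges (A : Type) [AddCommGroup A] : Type :=
  MulAction.orbitRel.Quotient (DihedralGroup 4) (Gen A)

theorem Nondegenerate.card_triangles [Finite A] (hA : Nondegenerate A) :
    Nat.card (Gen A) = Nat.card (Triangles A) * 12 := by
  rw [card_eq_card_orbits_mul_of_free fun g hg x ↦ hA.triangle_smul_ne hg x,
    DihedralGroup.nat_card]

theorem card_snd_two_torsion :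
    Nat.card {x : Gen A // x.snd + x.snd = 0} = Nat.card {x : Gen A // x.fst + x.fst = 0} :=
  Nat.card_congr ⟨fun x ↦ ⟨x.1.swap, x.2⟩, fun x ↦ ⟨x.1.swap, x.2⟩, fun _ ↦ rfl, fun _ ↦ rfl⟩

theorem Nondegenerate.card_edges [Finite A] (hA : Nondegenerate A) :
    Nat.card (Gen A) + 2 * Nat.card {x : Gen A // x.fst + x.fst = 0} =
      Nat.card (Edges A) * 8 := by
  classical
  have := Fintype.ofFinite (Gen A)
  have := Fintype.ofFinite (Edges A)
  have h := MulAction.sum_card_fixedBy_eq_card_orbits_mul_card_group (DihedralGroup 4) (Gen A)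
  have h1 : Fintype.card (MulAction.fixedBy (Gen A) (1 : DihedralGroup 4)) =
      Nat.card (Gen A) := by
    rw [← Nat.card_eq_fintype_card, MulAction.fixedBy_one_eq_univ, Nat.card_univ]
  have h2 : Fintype.card (MulAction.fixedBy (Gen A) (sr 1 : DihedralGroup 4)) =
      Nat.card {x : Gen A // x.fst + x.fst = 0} := by
    rw [← card_snd_two_torsion, ← Nat.card_eq_fintype_card]
    refine Nat.card_congr (Equiv.subtypeEquivRight fun x ↦ ⟨fun h ↦ ?_, fun h ↦ ?_⟩)
    · simpa [show (sr 1 : DihedralGroup 4) ≠ sr 3 by decide] using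
        hA.edge_smul_eq (by decide) h
    · apply edge_ext
      · change (1 : ℤ) • x.fst + (0 : ℤ) • x.snd = x.fst
        module
      · change (0 : ℤ) • x.fst + (-1 : ℤ) • x.snd = x.snd
        linear_combination (norm := module) -h
  have h3 : Fintype.card (MulAction.fixedBy (Gen A) (sr 3 : DihedralGroup 4)) =
      Nat.card {x : Gen A // x.fst + x.fst = 0} := by
    rw [← Nat.card_eq_fintype_card]
    refine Nat.card_congr (Equiv.subtypeEquivRight fun x ↦ ⟨fun h ↦ ?_, fun h ↦ ?_⟩)
    · simpa [show (sr 3 : DihedralGroup 4) ≠ sr 1 by decide] using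
        hA.edge_smul_eq (by decide) h
    · apply edge_ext
      · change (-1 : ℤ) • x.fst + (0 : ℤ) • x.snd = x.fst
        linear_combination (norm := module) -h
      · change (0 : ℤ) • x.fst + (1 : ℤ) • x.snd = x.snd
        module
  rw [← Finset.sum_subset (Finset.subset_univ {1, sr 1, sr 3}), Finset.sum_insert (by decide),
    Finset.sum_insert (by decide), Finset.sum_singleton, h1, h2, h3, DihedralGroup.card] at h
  · rw [Nat.card_eq_fintype_card (α := Edges A)]
    lia
  · intro g _ hg
    simp only [Finset.mem_insert, Finset.mem_singleton, not_or] at hg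
    rw [Fintype.card_eq_zero_iff]
    refine ⟨fun x ↦ ?_⟩
    rcases hA.edge_smul_eq hg.1 x.2 with h | h
    · exact hg.2.1 h.1
    · exact hg.2.2 h.1

theorem two_torsion_smul {g : DihedralGroup 4} {x : Gen A} :
    (x.fst + x.fst ≠ 0 ∧ x.snd + x.snd ≠ 0) ↔
      ((g • x).fst + (g • x).fst ≠ 0 ∧ (g • x).snd + (g • x).snd ≠ 0) := by
  refine dihedral_rel (n := 4)
    (R := fun x y : Gen A ↦ (x.fst + x.fst ≠ 0 ∧ x.snd + x.snd ≠ 0) ↔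
      (y.fst + y.fst ≠ 0 ∧ y.snd + y.snd ≠ 0))
    ⟨fun _ ↦ .rfl, .symm, .trans⟩ (fun x ↦ ?_) (fun x ↦ ?_) g x
  · rw [edge_r_one]
    simp [← neg_add, -neg_add_rev, and_comm]
  · rw [edge_sr_zero]
    simp [and_comm]

variable (A) in
/-- The generating pairs whose symbol is not forced to be two-torsion by antisymmetry. -/
def regular : SubMulAction (DihedralGroup 4) (Gen A) where
  carrier := {x | x.fst + x.fst ≠ 0 ∧ x.snd + x.snd ≠ 0}
  smul_mem' _ _ h := two_torsion_smul.1 h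

theorem mem_regular {x : Gen A} :
    x ∈ regular A ↔ x.fst + x.fst ≠ 0 ∧ x.snd + x.snd ≠ 0 := .rfl

variable (A) in
/-- Equivalence classes of regular edges. -/
abbrev RegularEdges : Type :=
  MulAction.orbitRel.Quotient (DihedralGroup 4) (regular A)

theorem Nondegenerate.card_regularEdges [Finite A] (hA : Nondegenerate A) :
    Nat.card (Gen A) = Nat.card (RegularEdges A) * 8 +
      2 * Nat.card {x : Gen A // x.fst + x.fst = 0} := by
  have h : Nat.card (regular A) = Nat.card (RegularEdges A) * 8 := by
    rw [card_eq_card_orbits_mul_of_free (G := DihedralGroup 4) (X := regular A),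
      DihedralGroup.nat_card]
    intro g hg x h
    rcases hA.edge_smul_eq hg (congrArg Subtype.val h) with h | h
    · exact x.2.2 h.2
    · exact x.2.1 h.2
  rw [← h, two_mul]
  nth_rw 1 [← card_snd_two_torsion]
  classical
  rw [← Nat.card_congr (Equiv.sumCompl fun x : Gen A ↦ x ∈ regular A), Nat.card_sum]
  refine congrArg (_ + ·) ?_
  have e : ∀ x : Gen A, x ∉ regular A ↔ x.snd + x.snd = 0 ∨ x.fst + x.fst = 0 := fun x ↦ by
    rw [mem_regular]
    tauto
  rw [Nat.card_congr (Equiv.subtypeEquivRight e)]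
  rw [← Nat.card_sum]
  refine Nat.card_congr (subtypeOrEquiv _ _ ?_)
  rw [Pi.disjoint_iff]
  exact fun x ↦ by simpa [Prop.disjoint_iff] using fun h₁ h₂ ↦ (hA x).2 ⟨h₂, h₁⟩

end Count

end KPT

namespace KPT

open DihedralGroup Gen

variable {A : Type} [AddCommGroup A]

theorem invariant_triangle {T : Type} {φ : Gen A → T} (hs : ∀ x, φ x.swap = φ x)
    (hr : ∀ x, φ x.rot = φ x) (hn : ∀ x, φ x.neg = φ x) (g : DihedralGroup 6) (x : Gen A) :
    φ (g • x) = φ x := by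
  refine dihedral_rel (n := 6) (R := fun x y : Gen A ↦ φ y = φ x)
    ⟨fun _ ↦ rfl, .symm, fun h₁ h₂ ↦ h₂.trans h₁⟩ (fun x ↦ ?_) (fun x ↦ ?_) g x
  · rw [triangle_r_one, hn, hr, hr]
  · rw [triangle_sr_zero, hs]

theorem invariant_edge {T : Type} {φ : Gen A → T} (hs : ∀ x, φ x.swap = φ x)
    (hf : ∀ x, φ x.flip = φ x) (g : DihedralGroup 4) (x : Gen A) :
    φ (g • x) = φ x := by
  refine dihedral_rel (n := 4) (R := fun x y : Gen A ↦ φ y = φ x)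
    ⟨fun _ ↦ rfl, .symm, fun h₁ h₂ ↦ h₂.trans h₁⟩ (fun x ↦ ?_) (fun x ↦ ?_) g x
  · rw [edge_r_one, hf, hs]
  · rw [edge_sr_zero, hs]

theorem triangles_mk_swap (x : Gen A) : (⟦x.swap⟧ : Triangles A) = ⟦x⟧ := by
  rw [← triangle_sr_zero]; exact Quotient.sound ⟨_, rfl⟩

theorem triangles_mk_smul (g : DihedralGroup 6) (x : Gen A) :
    (⟦g • x⟧ : Triangles A) = ⟦x⟧ := Quotient.sound ⟨_, rfl⟩

theorem triangle_r_three (x : Gen A) : (r 3 : DihedralGroup 6) • x = x.neg := by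
  apply triangle_ext
  · change (-1 : ℤ) • x.fst + (0 : ℤ) • x.snd = -x.fst
    module
  · change (0 : ℤ) • x.fst + (-1 : ℤ) • x.snd = -x.snd
    module

theorem triangles_mk_neg (x : Gen A) : (⟦x.neg⟧ : Triangles A) = ⟦x⟧ := by
  rw [← triangle_r_three]; exact Quotient.sound ⟨_, rfl⟩

theorem triangles_mk_rot (x : Gen A) : (⟦x.rot⟧ : Triangles A) = ⟦x⟧ := by
  have : (r 2 : DihedralGroup 6) • x = x.rot := by
    apply triangle_ext
    · change (0 : ℤ) • x.fst + (1 : ℤ) • x.snd = x.snd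
      module
    · change (-1 : ℤ) • x.fst + (-1 : ℤ) • x.snd = -x.fst - x.snd
      module
  rw [← this]; exact Quotient.sound ⟨_, rfl⟩

theorem edges_mk_swap (x : Gen A) : (⟦x.swap⟧ : Edges A) = ⟦x⟧ := by
  rw [← edge_sr_zero]; exact Quotient.sound ⟨_, rfl⟩

theorem edges_mk_flip (x : Gen A) : (⟦x.flip⟧ : Edges A) = ⟦x⟧ := by
  rw [← edge_sr_three]; exact Quotient.sound ⟨_, rfl⟩

section Functions

variable {N : Type} [AddCommGroup N]

/-- Symmetric functions on generating pairs which change sign with the first entry. -/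
structure IsEdge (f : Gen A → N) : Prop where
  swap : ∀ x, f x.swap = f x
  flip : ∀ x, f x.flip = -f x

/-- The sum of the values of a function along the edges of a triangle. -/
def tri (f : Gen A → N) (x : Gen A) : N := f x + f x.rot + f x.rot.rot

theorem IsEdge.neg {f : Gen A → N} (hf : IsEdge f) (x : Gen A) : f x.neg = f x := by
  rw [← flip_swap_flip_swap, hf.flip, hf.swap, hf.flip, hf.swap, _root_.neg_neg]

theorem tri_swap {f : Gen A → N} (hs : ∀ x, f x.swap = f x) (x : Gen A) :
    tri f x.swap = tri f x := by
  rw [tri, rot_swap, rot_swap, hs, hs, rot_rot_rot, hs, tri]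
  abel

theorem tri_rot (f : Gen A → N) (x : Gen A) : tri f x.rot = tri f x := by
  rw [tri, tri, rot_rot_rot]
  abel

theorem tri_neg {f : Gen A → N} (hn : ∀ x, f x.neg = f x) (x : Gen A) :
    tri f x.neg = tri f x := by
  rw [tri, tri, rot_neg, rot_neg, hn, hn, hn]

theorem tri_sub (f g : Gen A → N) (x : Gen A) : tri (f - g) x = tri f x - tri g x := by
  simp only [tri, Pi.sub_apply]
  abel

theorem IsEdge.tri_smul {f : Gen A → N} (hf : IsEdge f) (g : DihedralGroup 6) (x : Gen A) :
    tri f (g • x) = tri f x :=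
  invariant_triangle (tri_swap hf.swap) (tri_rot f) (tri_neg hf.neg) g x

end Functions

section Boundary

variable (R : Type) [CommRing R] (A)

/-- The module of antisymmetric edge functions. -/
def edgeFunctions : Submodule R (Gen A → R) where
  carrier := {f | IsEdge f}
  add_mem' hf hg := ⟨fun x ↦ by simp [hf.swap, hg.swap],
    fun x ↦ by simp [hf.flip, hg.flip, add_comm]⟩
  zero_mem' := ⟨fun _ ↦ rfl, fun _ ↦ by simp⟩
  smul_mem' c f hf := ⟨fun x ↦ by simp [hf.swap], fun x ↦ by simp [hf.flip]⟩

/-- The coboundary, from functions on edges to functions on triangles. -/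
def coboundary : edgeFunctions A R →ₗ[R] (Triangles A → R) where
  toFun f := Quotient.lift (tri f.1) (by
    rintro x y ⟨g, rfl⟩
    exact f.2.tri_smul g y)
  map_add' f g := by
    ext o
    induction o using Quotient.inductionOn with | _ x
    simp only [Quotient.lift_mk, Pi.add_apply, tri, Submodule.coe_add]
    abel
  map_smul' c f := by
    ext o
    induction o using Quotient.inductionOn with | _ x
    simp [Quotient.lift_mk, tri, mul_add]

variable {A} {R}

@[simp]
theorem coboundary_mk (f : edgeFunctions A R) (x : Gen A) :
    coboundary A R f ⟦x⟧ = tri f.1 x := rfl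

variable (R) in
open Classical in
/-- The indicator function of the orbit of an edge under its rotations and reversals. -/
noncomputable def halfEdge (x y : Gen A) : R :=
  if y = x ∨ y = x.neg ∨ y = x.swap ∨ y = x.swap.neg then 1 else 0

theorem halfEdge_swap (x y : Gen A) : halfEdge R x y.swap = halfEdge R x y := by
  unfold halfEdge
  congr 1
  have h (z : Gen A) : y.swap = z ↔ y = z.swap :=
    ⟨fun h ↦ by rw [← h, swap_swap], fun h ↦ by rw [h, swap_swap]⟩
  simp only [h, swap_neg, swap_swap, eq_iff_iff]
  tauto

theorem halfEdge_neg (x y : Gen A) : halfEdge R x y.neg = halfEdge R x y := by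
  unfold halfEdge
  congr 1
  have h (z : Gen A) : y.neg = z ↔ y = z.neg :=
    ⟨fun h ↦ by rw [← h, Gen.neg_neg], fun h ↦ by rw [h, Gen.neg_neg]⟩
  simp only [h, Gen.neg_neg, eq_iff_iff]
  tauto

theorem halfEdge_flip (x y : Gen A) : halfEdge R x y.flip = halfEdge R x.flip y := by
  unfold halfEdge
  congr 1
  have h (z : Gen A) : y.flip = z ↔ y = z.flip :=
    ⟨fun h ↦ by rw [← h, Gen.flip_flip], fun h ↦ by rw [h, Gen.flip_flip]⟩
  have e : x.flip.swap = x.swap.flip.neg := by ext <;> simp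
  simp only [h, flip_neg, e, Gen.neg_neg, eq_iff_iff]
  tauto

open Classical in
theorem Nondegenerate.tri_halfEdge (hA : Nondegenerate A) (x : Gen A) (y : Gen A) :
    tri (halfEdge R x) y = (Pi.single ⟦x⟧ 1 : Triangles A → R) ⟦y⟧ := by
  by_cases hxy : (⟦y⟧ : Triangles A) = ⟦x⟧
  · obtain ⟨g, rfl⟩ := Quotient.exact hxy
    rw [hxy, Pi.single_eq_same]
    refine (invariant_triangle (tri_swap (halfEdge_swap x)) (tri_rot _)
      (tri_neg (halfEdge_neg x)) g x).trans ?_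
    have h₁ : halfEdge R x x.rot = 0 := by
      refine if_neg ?_
      rintro (h | h | h | h) <;> have h₁ := congrArg fst h <;> have h₂ := congrArg snd h <;>
        simp only [fst_rot, snd_rot, fst_neg, snd_neg, fst_swap, snd_swap] at h₁ h₂
      · exact hA.snd_ne x 1 (by linear_combination (norm := module) h₁)
      · exact hA.snd_ne x (-1) (by linear_combination (norm := module) h₁)
      · exact hA.snd_ne x (-2) (by linear_combination (norm := module) -h₂)
      · exact hA.snd_ne x 0 (by linear_combination (norm := module) -h₂)
    have h₂ : halfEdge R x x.rot.rot = 0 := by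
      refine if_neg ?_
      rintro (h | h | h | h) <;> have h₁ := congrArg fst h <;> have h₂ := congrArg snd h <;>
        simp only [fst_rot, snd_rot, fst_neg, snd_neg, fst_swap, snd_swap] at h₁ h₂
      · exact hA.snd_ne x 1 (by linear_combination (norm := module) -h₂)
      · exact hA.snd_ne x (-1) (by linear_combination (norm := module) h₂)
      · exact hA.fst_ne x (-2) (by linear_combination (norm := module) -h₁)
      · exact hA.fst_ne x 0 (by linear_combination (norm := module) -h₁)
    rw [tri, h₁, h₂, halfEdge, if_pos (.inl rfl), add_zero, add_zero]
  · rw [Pi.single_eq_of_ne hxy]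
    have h (z : Gen A) (hz : (⟦z⟧ : Triangles A) = ⟦y⟧) : halfEdge R x z = 0 := by
      refine if_neg ?_
      rintro (rfl | rfl | rfl | rfl)
      · exact hxy hz.symm
      · exact hxy (hz.symm.trans (triangles_mk_neg x))
      · exact hxy (hz.symm.trans (triangles_mk_swap x))
      · exact hxy (hz.symm.trans ((triangles_mk_neg _).trans (triangles_mk_swap x)))
    rw [tri, h y rfl, h _ (triangles_mk_rot y), h _ ((triangles_mk_rot _).trans
      (triangles_mk_rot y)), add_zero, add_zero]

/-- A labelling of the connected components of the set of generating pairs. -/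
structure IsComponentMap {C : Type} (κ : Gen A → C) : Prop where
  surj : Function.Surjective κ
  swap : ∀ x, κ x.swap = κ x
  rot : ∀ x, κ x.rot = κ x
  flip : ∀ x, κ x.flip = κ x
  conn : ∀ R : Gen A → Gen A → Prop, Equivalence R → (∀ x, R x x.swap) → (∀ x, R x x.rot) →
    (∀ x, R x x.flip) → ∀ x y, κ x = κ y → R x y

variable {C : Type} {κ : Gen A → C}

theorem IsComponentMap.neg (hκ : IsComponentMap κ) (x : Gen A) : κ x.neg = κ x := by
  rw [← flip_swap_flip_swap, hκ.flip, hκ.swap, hκ.flip, hκ.swap]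

/-- The component of a triangle. -/
def IsComponentMap.triangle (hκ : IsComponentMap κ) : Triangles A → C :=
  Quotient.lift κ (by
    rintro x y ⟨g, rfl⟩
    exact invariant_triangle hκ.swap hκ.rot hκ.neg g y)

open Classical in
theorem Nondegenerate.single_sub_single_mem (hA : Nondegenerate A) (x : Gen A) :
    (Pi.single ⟦x⟧ 1 - Pi.single ⟦x.flip⟧ 1 : Triangles A → R) ∈
      LinearMap.range (coboundary A R) := by
  refine ⟨⟨halfEdge R x - halfEdge R x.flip, fun y ↦ ?_, fun y ↦ ?_⟩, ?_⟩
  · simp only [Pi.sub_apply, halfEdge_swap]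
  · simp only [Pi.sub_apply, halfEdge_flip, Gen.flip_flip, neg_sub]
  · ext o
    induction o using Quotient.inductionOn with | _ y
    rw [coboundary_mk, tri_sub, hA.tri_halfEdge, hA.tri_halfEdge, Pi.sub_apply]

open Classical in
theorem Nondegenerate.single_sub_single_mem_of_component (hA : Nondegenerate A)
    (hκ : IsComponentMap κ) {o o' : Triangles A} (h : hκ.triangle o = hκ.triangle o') :
    (Pi.single o 1 - Pi.single o' 1 : Triangles A → R) ∈
      LinearMap.range (coboundary A R) := by
  induction o using Quotient.inductionOn with | _ x
  induction o' using Quotient.inductionOn with | _ y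
  refine hκ.conn (fun x y ↦ (Pi.single ⟦x⟧ 1 - Pi.single ⟦y⟧ 1 : Triangles A → R) ∈
      LinearMap.range (coboundary A R)) ⟨fun x ↦ ?_, fun {x y} h ↦ ?_, fun {x y z} h₁ h₂ ↦ ?_⟩
      (fun x ↦ ?_) (fun x ↦ ?_) hA.single_sub_single_mem x y h
  · rw [sub_self]; exact zero_mem _
  · rw [← neg_sub]; exact neg_mem h
  · rw [← sub_add_sub_cancel]; exact add_mem h₁ h₂
  · rw [triangles_mk_swap, sub_self]; exact zero_mem _
  · rw [triangles_mk_rot, sub_self]; exact zero_mem _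

noncomputable instance [Finite A] : Fintype (Gen A) := Fintype.ofFinite _

noncomputable instance [Finite A] : Fintype (Triangles A) := Fintype.ofFinite _

variable (R) in
open Classical in
/-- The sums of a function on triangles over all components. -/
noncomputable def IsComponentMap.sum [Finite A] (hκ : IsComponentMap κ) :
    (Triangles A → R) →ₗ[R] (C → R) where
  toFun h c := ∑ o, if hκ.triangle o = c then h o else 0
  map_add' f g := by
    ext c
    simp only [Pi.add_apply, ← Finset.sum_add_distrib]
    exact Finset.sum_congr rfl fun o _ ↦ by split_ifs <;> simp
  map_smul' a f := by
    ext c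
    simp [Finset.mul_sum]

open Classical in
theorem IsComponentMap.sum_apply [Finite A] (hκ : IsComponentMap κ) (h : Triangles A → R) (c : C) :
    hκ.sum R h c = ∑ o, if hκ.triangle o = c then h o else 0 := rfl

theorem IsComponentMap.triangle_surjective (hκ : IsComponentMap κ) :
    Function.Surjective hκ.triangle := fun c ↦ by
  obtain ⟨x, rfl⟩ := hκ.surj c
  exact ⟨⟦x⟧, rfl⟩

theorem IsComponentMap.sum_surjective [Finite A] (hκ : IsComponentMap κ) :
    Function.Surjective (hκ.sum R) := fun w ↦ by
  classical
  choose rep hrep using hκ.triangle_surjective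
  refine ⟨fun o ↦ if o = rep (hκ.triangle o) then w (hκ.triangle o) else 0, ?_⟩
  ext c
  rw [hκ.sum_apply, Finset.sum_eq_single (rep c)]
  · simp [hrep]
  · intro o _ ho
    split_ifs with h₁ h₂
    · exact absurd (h₁ ▸ h₂) ho
    · rfl
    · rfl
  · simp

theorem Nondegenerate.mem_range_of_sum_eq_zero [Finite A] (hA : Nondegenerate A)
    (hκ : IsComponentMap κ) {h : Triangles A → R} (hh : hκ.sum R h = 0) :
    h ∈ LinearMap.range (coboundary A R) := by
  classical
  choose rep hrep using hκ.triangle_surjective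
  have hfin : Finite C := Finite.of_surjective _ hκ.triangle_surjective
  have := Fintype.ofFinite C
  have h₁ : ∑ o, h o • (Pi.single (rep (hκ.triangle o)) 1 : Triangles A → R) = 0 := by
    rw [← Finset.sum_fiberwise (g := hκ.triangle)]
    refine Finset.sum_eq_zero fun c _ ↦ ?_
    rw [Finset.sum_congr rfl (g := fun o ↦ h o • (Pi.single (rep c) 1 : Triangles A → R)),
      ← Finset.sum_smul, Finset.sum_filter, ← hκ.sum_apply, hh, Pi.zero_apply, zero_smul]
    intro o ho
    rw [(Finset.mem_filter.1 ho).2]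
  have h₂ : h = ∑ o, h o • (Pi.single o 1 - Pi.single (rep (hκ.triangle o)) 1 :
      Triangles A → R) := by
    simp only [smul_sub, Finset.sum_sub_distrib, h₁, sub_zero]
    ext o
    simp [Finset.sum_apply, Pi.single_apply]
  rw [h₂]
  exact Submodule.sum_mem _ fun o _ ↦ Submodule.smul_mem _ _
    (hA.single_sub_single_mem_of_component hκ (hrep _).symm)

theorem Nondegenerate.sum_triangles [Finite A] (hA : Nondegenerate A) (φ : Triangles A → R) :
    ∑ x : Gen A, φ ⟦x⟧ = 12 * ∑ o, φ o := by
  classical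
  rw [← Finset.sum_fiberwise (g := fun x : Gen A ↦ (⟦x⟧ : Triangles A)), Finset.mul_sum]
  refine Finset.sum_congr rfl fun o _ ↦ ?_
  rw [Finset.sum_congr rfl (g := fun _ ↦ φ o), Finset.sum_const, nsmul_eq_mul]
  · congr 1
    induction o using Quotient.inductionOn with | _ x
    have : Finset.univ.filter (fun y : Gen A ↦ (⟦y⟧ : Triangles A) = ⟦x⟧) =
        Finset.univ.image fun g : DihedralGroup 6 ↦ g • x := by
      ext y
      simp only [Finset.mem_filter, Finset.mem_univ, true_and, Finset.mem_image]
      exact ⟨fun h ↦ Quotient.exact h, fun ⟨g, h⟩ ↦ h ▸ triangles_mk_smul g x⟩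
    rw [this, Finset.card_image_of_injective, Finset.card_univ, DihedralGroup.card]
    · norm_num
    · intro g g' h
      by_contra hne
      refine hA.triangle_smul_ne (g := g'⁻¹ * g) (fun h ↦ hne ?_) x ?_
      · rw [inv_mul_eq_one] at h
        exact h.symm
      · simp only at h
        rw [mul_smul, h, inv_smul_smul]
  · intro x hx
    rw [(Finset.mem_filter.1 hx).2]

theorem Nondegenerate.sum_coboundary [Finite A] [CharZero R] [IsDomain R] (hA : Nondegenerate A)
    (hκ : IsComponentMap κ) (f : edgeFunctions A R) : hκ.sum R (coboundary A R f) = 0 := by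
  classical
  ext c
  have h := hA.sum_triangles fun o ↦ if hκ.triangle o = c then coboundary A R f o else 0
  rw [← hκ.sum_apply] at h
  let w : Gen A → R := fun x ↦ if κ x = c then f.1 x else 0
  have hflip : ∑ x, w x = 0 := by
    have : ∑ x, w x = -∑ x, w x := by
      rw [← Finset.sum_neg_distrib,
        ← (Function.Involutive.bijective (Gen.flip_flip (A := A))).sum_comp w]
      refine Finset.sum_congr rfl fun x _ ↦ ?_
      simp only [w, hκ.flip, f.2.flip]
      split_ifs <;> simp
    exact self_eq_neg.1 this
  have hrot (g : Gen A → R) : ∑ x : Gen A, g x.rot = ∑ x, g x :=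
    (Function.bijective_iff_has_inverse.2 ⟨fun x : Gen A ↦ x.rot.rot, rot_rot_rot,
      rot_rot_rot⟩).sum_comp g
  have hsum : ∑ x : Gen A, (if hκ.triangle ⟦x⟧ = c then coboundary A R f ⟦x⟧ else 0) = 0 := by
    have (x : Gen A) : (if hκ.triangle ⟦x⟧ = c then coboundary A R f ⟦x⟧ else 0) =
        w x + w x.rot + w x.rot.rot := by
      simp only [coboundary_mk, tri, w, hκ.rot]
      change (if κ x = c then _ else _) = _
      split_ifs <;> simp
    simp only [this, Finset.sum_add_distrib]
    rw [hrot (fun x ↦ w x.rot), hrot w, hflip, add_zero, add_zero]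
  rw [hsum] at h
  exact (mul_eq_zero.1 h.symm).resolve_left (by norm_num)

theorem Nondegenerate.range_coboundary [Finite A] [CharZero R] [IsDomain R] (hA : Nondegenerate A)
    (hκ : IsComponentMap κ) :
    LinearMap.range (coboundary A R) = LinearMap.ker (hκ.sum R) := by
  ext h
  refine ⟨?_, fun hh ↦ hA.mem_range_of_sum_eq_zero hκ hh⟩
  rintro ⟨f, rfl⟩
  exact hA.sum_coboundary hκ f

theorem Nondegenerate.coboundary_surjective [Finite A] [CharP R 2] (hA : Nondegenerate A)
    (hκ : IsComponentMap κ) (hc : ∀ x y, κ x = κ y) {x : Gen A} (hx : x.fst + x.fst = 0) :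
    Function.Surjective (coboundary A R) := by
  classical
  have hsingle : (Pi.single ⟦x⟧ 1 : Triangles A → R) ∈ LinearMap.range (coboundary A R) := by
    have hflip : x.flip = x := by
      ext
      · rw [fst_flip]
        exact (eq_neg_of_add_eq_zero_left hx).symm
      · rfl
    refine ⟨⟨halfEdge R x, halfEdge_swap x, fun y ↦ ?_⟩, ?_⟩
    · rw [halfEdge_flip, hflip, CharTwo.neg_eq]
    · ext o
      induction o using Quotient.inductionOn with | _ y
      rw [coboundary_mk, hA.tri_halfEdge]
  rw [← LinearMap.range_eq_top, eq_top_iff]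
  intro h _
  have : h = ∑ o, h o • (Pi.single o 1 : Triangles A → R) := by
    ext o
    simp [Finset.sum_apply, Pi.single_apply]
  rw [this]
  refine Submodule.sum_mem _ fun o _ ↦ Submodule.smul_mem _ _ ?_
  rw [← sub_add_cancel (Pi.single o 1) (Pi.single ⟦x⟧ 1 : Triangles A → R)]
  refine add_mem (hA.single_sub_single_mem_of_component hκ ?_) hsingle
  induction o using Quotient.inductionOn with | _ y
  exact hc y x

end Boundary

end KPT

namespace KPT

open DihedralGroup Gen

variable {A : Type} [AddCommGroup A]

/-- A choice of signs which is odd away from the two-torsion. -/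
structure IsSign (σ : A → ℤ) : Prop where
  mul_self : ∀ a, σ a * σ a = 1
  neg : ∀ a, a + a ≠ 0 → σ (-a) = -σ a

variable (A) in
theorem exists_isSign [Finite A] : ∃ σ : A → ℤ, IsSign σ := by
  obtain ⟨n, ⟨e⟩⟩ := Finite.exists_equiv_fin A
  refine ⟨fun a ↦ if e a ≤ e (-a) then 1 else -1, fun a ↦ ?_, fun a ha ↦ ?_⟩
  · split_ifs <;> rfl
  · have hne : e a ≠ e (-a) := fun h ↦ ha (by rw [add_eq_zero_iff_eq_neg]; exact e.injective h)
    simp only [_root_.neg_neg]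
    rcases lt_or_gt_of_ne hne with h | h
    · rw [if_neg h.not_ge, if_pos h.le]
    · rw [if_pos h.le, if_neg h.not_ge, _root_.neg_neg]

/-- The sign of a generating pair. -/
def Gen.sign (σ : A → ℤ) (x : Gen A) : ℤ := σ x.fst * σ x.snd

section Sign

variable {σ : A → ℤ}

theorem Gen.sign_swap (x : Gen A) : x.swap.sign σ = x.sign σ := mul_comm _ _

theorem IsSign.sign_flip (hσ : IsSign σ) {x : Gen A} (hx : x.fst + x.fst ≠ 0) :
    x.flip.sign σ = -x.sign σ := by
  rw [Gen.sign, Gen.sign, fst_flip, snd_flip, hσ.neg _ hx, neg_mul]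

theorem IsSign.sign_mul_self (hσ : IsSign σ) (x : Gen A) : x.sign σ * x.sign σ = 1 := by
  rw [Gen.sign, mul_mul_mul_comm, hσ.mul_self, hσ.mul_self, one_mul]

theorem IsSign.sign_smul_smul {N : Type} [AddCommGroup N] (hσ : IsSign σ) (x : Gen A) (a : N) :
    x.sign σ • x.sign σ • a = a := by
  rw [smul_smul, hσ.sign_mul_self, one_smul]

theorem flip_eq_self {x : Gen A} (hx : x.fst + x.fst = 0) : x.flip = x := by
  ext
  · rw [fst_flip]
    exact (eq_neg_of_add_eq_zero_left hx).symm
  · rfl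

variable {N : Type} [AddCommGroup N]

theorem IsEdge.sign_smul_swap {f : Gen A → N} (hf : IsEdge f) (x : Gen A) :
    x.swap.sign σ • f x.swap = x.sign σ • f x := by rw [hf.swap, sign_swap]

theorem IsEdge.sign_smul_flip {f : Gen A → N} (hf : IsEdge f) (hσ : IsSign σ) (x : Gen A) :
    x.flip.sign σ • f x.flip = x.sign σ • f x := by
  by_cases hx : x.fst + x.fst = 0
  · rw [flip_eq_self hx]
  · rw [hf.flip, hσ.sign_flip hx, neg_smul_neg]

theorem swap_mem_regular {x : Gen A} : x.swap ∈ regular A ↔ x ∈ regular A := by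
  rw [mem_regular, mem_regular, fst_swap, snd_swap, and_comm]

theorem flip_mem_regular {x : Gen A} : x.flip ∈ regular A ↔ x ∈ regular A := by
  rw [mem_regular, mem_regular, fst_flip, snd_flip, ← neg_add, neg_ne_zero]

open Classical in
/-- The edge function attached to a function on regular edges. -/
noncomputable def twist (σ : A → ℤ) (φ : regular A → N) (x : Gen A) : N :=
  if hx : x ∈ regular A then x.sign σ • φ ⟨x, hx⟩ else 0

theorem twist_of_mem {φ : regular A → N} {x : Gen A} (hx : x ∈ regular A) :
    twist σ φ x = x.sign σ • φ ⟨x, hx⟩ := dif_pos hx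

theorem twist_of_notMem {φ : regular A → N} {x : Gen A} (hx : x ∉ regular A) :
    twist σ φ x = 0 := dif_neg hx

theorem IsSign.isEdge_twist (hσ : IsSign σ) {φ : regular A → N}
    (hs : ∀ x : regular A, φ ⟨x.1.swap, swap_mem_regular.2 x.2⟩ = φ x)
    (hf : ∀ x : regular A, φ ⟨x.1.flip, flip_mem_regular.2 x.2⟩ = φ x) :
    IsEdge (twist σ φ) := by
  refine ⟨fun x ↦ ?_, fun x ↦ ?_⟩
  · by_cases hx : x ∈ regular A
    · rw [twist_of_mem hx, twist_of_mem (swap_mem_regular.2 hx), sign_swap, hs ⟨x, hx⟩]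
    · rw [twist_of_notMem hx, twist_of_notMem fun h ↦ hx (swap_mem_regular.1 h)]
  · by_cases hx : x ∈ regular A
    · rw [twist_of_mem hx, twist_of_mem (flip_mem_regular.2 hx), hσ.sign_flip hx.1,
        hf ⟨x, hx⟩, neg_smul]
    · rw [twist_of_notMem hx, twist_of_notMem fun h ↦ hx (flip_mem_regular.1 h), neg_zero]

theorem IsEdge.two_smul_eq_zero {f : Gen A → N} (hf : IsEdge f) {x : Gen A}
    (hx : x ∉ regular A) : f x + f x = 0 := by
  have key {y : Gen A} (hy : y.fst + y.fst = 0) : f y + f y = 0 := by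
    have := hf.flip y
    rw [flip_eq_self hy] at this
    exact add_eq_zero_iff_eq_neg.2 this
  rw [mem_regular, not_and_or, not_not, not_not] at hx
  rcases hx with hx | hx
  · exact key hx
  · rw [← hf.swap]
    exact key (y := x.swap) hx

end Sign

theorem regularEdges_mk_swap (x : regular A) :
    (⟦⟨x.1.swap, swap_mem_regular.2 x.2⟩⟧ : RegularEdges A) = ⟦x⟧ :=
  Quotient.sound ⟨sr 0, Subtype.ext (edge_sr_zero x.1)⟩

theorem regularEdges_mk_flip (x : regular A) :
    (⟦⟨x.1.flip, flip_mem_regular.2 x.2⟩⟧ : RegularEdges A) = ⟦x⟧ :=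
  Quotient.sound ⟨sr 3, Subtype.ext (edge_sr_three x.1)⟩

variable (A) in
theorem finrank_edgeFunctions_rat [Finite A] :
    Module.finrank ℚ (edgeFunctions A ℚ) = Nat.card (RegularEdges A) := by
  classical
  obtain ⟨σ, hσ⟩ := exists_isSign A
  have := Fintype.ofFinite (RegularEdges A)
  let e : (RegularEdges A → ℚ) ≃ₗ[ℚ] edgeFunctions A ℚ :=
    { toFun := fun h ↦ ⟨twist σ fun x ↦ h ⟦x⟧, hσ.isEdge_twist
        (fun x ↦ congrArg h (regularEdges_mk_swap x)) fun x ↦ congrArg h (regularEdges_mk_flip x)⟩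
      map_add' := fun f g ↦ by
        ext x
        by_cases hx : x ∈ regular A
        · simp [twist_of_mem hx]
        · simp [twist_of_notMem hx]
      map_smul' := fun c f ↦ by
        ext x
        by_cases hx : x ∈ regular A
        · simp [twist_of_mem hx, mul_left_comm]
        · simp [twist_of_notMem hx]
      invFun := fun f ↦ Quotient.lift (fun x : regular A ↦ x.1.sign σ • f.1 x.1) (by
        rintro x y ⟨g, rfl⟩
        exact invariant_edge (φ := fun z : Gen A ↦ z.sign σ • f.1 z) f.2.sign_smul_swap
          (f.2.sign_smul_flip hσ) g y.1)
      left_inv := fun h ↦ by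
        ext o
        induction o using Quotient.inductionOn with | _ x
        change x.1.sign σ • twist σ (fun y ↦ (h (⟦y⟧) : ℚ)) x.1 = _
        rw [twist_of_mem x.2, hσ.sign_smul_smul]
      right_inv := fun f ↦ by
        ext x
        by_cases hx : x ∈ regular A
        · simp only [twist_of_mem hx, Quotient.lift_mk, hσ.sign_smul_smul]
        · simp only [twist_of_notMem hx]
          linarith [f.2.two_smul_eq_zero hx] }
  rw [← e.finrank_eq, Module.finrank_pi, Nat.card_eq_fintype_card]

variable (A) in
theorem finrank_edgeFunctions_zmod_two [Finite A] :
    Module.finrank (ZMod 2) (edgeFunctions A (ZMod 2)) = Nat.card (Edges A) := by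
  have := Fintype.ofFinite (Edges A)
  let e : (Edges A → ZMod 2) ≃ₗ[ZMod 2] edgeFunctions A (ZMod 2) :=
    { toFun := fun h ↦ ⟨fun x ↦ h ⟦x⟧, fun x ↦ congrArg h (edges_mk_swap x), fun x ↦ by
        rw [edges_mk_flip, CharTwo.neg_eq]⟩
      map_add' := fun _ _ ↦ rfl
      map_smul' := fun _ _ ↦ rfl
      invFun := fun f ↦ Quotient.lift f.1 (by
        rintro x y ⟨g, rfl⟩
        exact invariant_edge f.2.swap (fun x ↦ by rw [f.2.flip, CharTwo.neg_eq]) g y)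
      left_inv := fun h ↦ by
        ext o
        induction o using Quotient.inductionOn with | _ x
        rfl
      right_inv := fun f ↦ rfl }
  rw [← e.finrank_eq, Module.finrank_pi, Nat.card_eq_fintype_card]

variable {C : Type} {κ : Gen A → C}

theorem Nondegenerate.finrank_ker_coboundary_rat [Finite A] (hA : Nondegenerate A)
    (hκ : IsComponentMap κ) :
    Module.finrank ℚ (LinearMap.ker (coboundary A ℚ)) + Nat.card (Triangles A) =
      Nat.card (RegularEdges A) + Nat.card C := by
  have : Finite C := Finite.of_surjective _ hκ.surj
  have := Fintype.ofFinite C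
  have h₁ := (coboundary A ℚ).finrank_range_add_finrank_ker
  have h₂ := (hκ.sum ℚ).finrank_range_add_finrank_ker
  rw [LinearMap.range_eq_top.2 hκ.sum_surjective, finrank_top, ← hA.range_coboundary hκ,
    Module.finrank_pi, Module.finrank_pi] at h₂
  rw [finrank_edgeFunctions_rat] at h₁
  rw [Nat.card_eq_fintype_card, Nat.card_eq_fintype_card (α := C)]
  lia

theorem Nondegenerate.finrank_ker_coboundary_zmod_two [Finite A] (hA : Nondegenerate A)
    (hκ : IsComponentMap κ) (hc : ∀ x y, κ x = κ y) {x : Gen A} (hx : x.fst + x.fst = 0) :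
    Module.finrank (ZMod 2) (LinearMap.ker (coboundary A (ZMod 2))) + Nat.card (Triangles A) =
      Nat.card (Edges A) := by
  have h₁ := (coboundary A (ZMod 2)).finrank_range_add_finrank_ker
  rw [LinearMap.range_eq_top.2 (hA.coboundary_surjective hκ hc hx), finrank_top,
    Module.finrank_pi, finrank_edgeFunctions_zmod_two] at h₁
  rw [Nat.card_eq_fintype_card]
  lia

/-- Cocycles with values in the rationals whose reduction modulo one is twice a given cocycle. -/
theorem Nondegenerate.exists_lift [Finite A] (hA : Nondegenerate A)
    (hκ : IsComponentMap κ) {N : Type} [AddCommGroup N] (π : ℚ →+ N)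
    (hπ : Function.Surjective π) (hker : ∀ q, π q = 0 ↔ ∃ n : ℤ, (n : ℚ) = q)
    {f : Gen A → N} (hf : IsEdge f) (hd : ∀ x, tri f x = 0) :
    ∃ F : Gen A → ℚ, IsEdge F ∧ (∀ x, tri F x = 0) ∧ ∀ x, π (F x) = f x + f x := by
  classical
  obtain ⟨σ, hσ⟩ := exists_isSign A
  choose l hl using hπ
  let F : Gen A → ℚ := twist σ fun x ↦ 2 * l (x.1.sign σ • f x.1)
  have hF : IsEdge F := hσ.isEdge_twist
    (fun x ↦ by rw [hf.sign_smul_swap]) fun x ↦ by rw [hf.sign_smul_flip hσ]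
  have hπF (x : Gen A) : π (F x) = f x + f x := by
    by_cases hx : x ∈ regular A
    · rw [show F x = _ from twist_of_mem hx, map_zsmul, two_mul, map_add, hl, smul_add,
        hσ.sign_smul_smul]
    · rw [show F x = _ from twist_of_notMem hx, map_zero, hf.two_smul_eq_zero hx]
  have hint (o : Triangles A) : ∃ n : ℤ, (n : ℚ) = coboundary A ℚ ⟨F, hF⟩ o := by
    induction o using Quotient.inductionOn with | _ x
    rw [← hker, coboundary_mk, tri, map_add, map_add, hπF, hπF, hπF]
    have := hd x
    rw [tri] at this
    linear_combination (norm := abel) this + this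
  choose h hh using hint
  have hsum : hκ.sum ℤ h = 0 := by
    ext c
    have := congrFun (hA.sum_coboundary hκ ⟨F, hF⟩) c
    rw [hκ.sum_apply, Pi.zero_apply] at this
    rw [hκ.sum_apply, Pi.zero_apply]
    simp only [← hh] at this
    exact_mod_cast this
  obtain ⟨G, hG⟩ := hA.mem_range_of_sum_eq_zero hκ hsum
  refine ⟨fun x ↦ F x - G.1 x, ⟨fun x ↦ ?_, fun x ↦ ?_⟩, fun x ↦ ?_, fun x ↦ ?_⟩
  · rw [hF.swap, G.2.swap]
  · rw [hF.flip, G.2.flip]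
    push_cast
    ring
  · have h₁ := hh ⟦x⟧
    rw [← hG, coboundary_mk, coboundary_mk, tri, tri] at h₁
    push_cast at h₁
    rw [tri]
    linear_combination -h₁
  · rw [map_sub, hπF, (hker _).2 ⟨_, rfl⟩, sub_zero]

end KPT

namespace KPT

open Gen

variable {A : Type} [AddCommGroup A] {N : Type} [AddCommGroup N]

/-- A generating pair as a tuple. -/
def Gen.tuple (x : Gen A) : GenTuple 2 A :=
  ⟨![x.fst, x.snd], by
    rw [Matrix.range_cons_cons_empty]
    exact x.2⟩

theorem Gen.tuple_surjective : Function.Surjective (Gen.tuple (A := A)) := fun β ↦ by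
  have h : ![β.1 0, β.1 1] = β.1 := (List.ofFn_inj.1 rfl)
  exact ⟨⟨(β.1 0, β.1 1), by
    have := β.2
    rwa [← h, Matrix.range_cons_cons_empty] at this⟩, Subtype.ext h⟩

/-- The pair `(a - b, b)`. -/
def Gen.subFst (x : Gen A) : Gen A :=
  ⟨(x.fst - x.snd, x.snd), closure_eq_top_of_combination x.2 (a := 1) (b := 1) (c := 0) (d := 1)
    (by module) (by module)⟩

/-- The pair `(a, b - a)`. -/
def Gen.subSnd (x : Gen A) : Gen A :=
  ⟨(x.fst, x.snd - x.fst), closure_eq_top_of_combination x.2 (a := 1) (b := 0) (c := 1) (d := 1)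
    (by module) (by module)⟩

@[simp] theorem Gen.fst_subFst (x : Gen A) : x.subFst.fst = x.fst - x.snd := rfl
@[simp] theorem Gen.snd_subFst (x : Gen A) : x.subFst.snd = x.snd := rfl
@[simp] theorem Gen.fst_subSnd (x : Gen A) : x.subSnd.fst = x.fst := rfl
@[simp] theorem Gen.snd_subSnd (x : Gen A) : x.subSnd.snd = x.snd - x.fst := rfl

theorem Gen.tuple_swap (x : Gen A) :
    x.swap.tuple.1 = x.tuple.1 ∘ (Equiv.swap 0 1 : Equiv.Perm (Fin 2)) := by
  ext i
  fin_cases i <;> rfl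

theorem Gen.tuple_flip (x : Gen A) :
    x.flip.tuple.1 = Function.update x.tuple.1 0 (-x.tuple.1 0) := by
  ext i
  fin_cases i <;> rfl

theorem Gen.tuple_subFst (x : Gen A) :
    x.subFst.tuple.1 = Function.update x.tuple.1 0 (x.tuple.1 0 - x.tuple.1 1) := by
  ext i
  fin_cases i <;> rfl

theorem Gen.tuple_subSnd (x : Gen A) :
    x.subSnd.tuple.1 = Function.update x.tuple.1 1 (x.tuple.1 1 - x.tuple.1 0) := by
  ext i
  fin_cases i <;> rfl

/-- Functions on generating pairs which define homomorphisms on `M₂(A)`. -/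
structure IsSymbol (f : Gen A → N) : Prop where
  swap : ∀ x, f x.swap = f x
  eq_add : ∀ x, f x = f x.subFst + f x.subSnd

theorem IsEdge.tri_eq {f : Gen A → N} (hf : IsEdge f) (x : Gen A) :
    tri f x.swap.flip.swap = f x.subFst + f x.subSnd - f x := by
  have h₁ : f x.swap.flip.swap = -f x := by rw [hf.swap, hf.flip, hf.swap]
  have h₂ : x.swap.flip.swap.rot = x.subFst.neg.swap := by ext <;> simp; abel
  have h₃ : x.swap.flip.swap.rot.rot = x.subSnd.swap := by ext <;> simp; abel
  rw [tri, h₃, h₁, h₂, hf.swap, hf.swap, hf.neg]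
  abel

theorem IsEdge.isSymbol_iff {f : Gen A → N} (hf : IsEdge f) :
    IsSymbol f ↔ ∀ x, tri f x = 0 := by
  refine ⟨fun h x ↦ ?_, fun h ↦ ⟨hf.swap, fun x ↦ ?_⟩⟩
  · have : x = x.swap.flip.swap.swap.flip.swap := by simp
    rw [this, hf.tri_eq, h.eq_add x.swap.flip.swap, sub_self]
  · exact (sub_eq_zero.1 ((hf.tri_eq x).symm.trans (h _))).symm

section Hom

theorem exists_quotient_hom {X : Type} {S : Set (FreeAbelianGroup X)} (f : X → N)
    (h : ∀ r ∈ S, FreeAbelianGroup.lift f r = 0) :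
    ∃ φ : FreeAbelianGroup X ⧸ AddSubgroup.closure S →+ N,
      ∀ x, φ (QuotientAddGroup.mk (FreeAbelianGroup.of x)) = f x :=
  ⟨QuotientAddGroup.lift _ (FreeAbelianGroup.lift f)
    ((AddSubgroup.closure_le (AddMonoidHom.ker _)).2 h), fun x ↦ by simp⟩

theorem exists_tuple_function (f : Gen A → N) :
    ∃ g : GenTuple 2 A → N, ∀ x : Gen A, g x.tuple = f x := by
  refine ⟨Function.extend Gen.tuple f fun _ ↦ 0, fun x ↦ Function.Injective.extend_apply
    (fun x y h ↦ ?_) f _ x⟩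
  exact Gen.ext (congrFun (congrArg Subtype.val h) 0) (congrFun (congrArg Subtype.val h) 1)

theorem lift_relO {f : Gen A → N} (hf : ∀ x, f x.swap = f x) {g : GenTuple 2 A → N}
    (hg : ∀ x : Gen A, g x.tuple = f x) {r : FreeAbelianGroup (GenTuple 2 A)}
    (hr : r ∈ relO 2 A) : FreeAbelianGroup.lift g r = 0 := by
  obtain ⟨β, β', σ, h, rfl⟩ := hr
  obtain ⟨x, rfl⟩ := tuple_surjective β
  rw [map_sub, FreeAbelianGroup.lift_apply_of, FreeAbelianGroup.lift_apply_of, sub_eq_zero]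
  have hperm : ∀ σ : Equiv.Perm (Fin 2), σ = 1 ∨ σ = Equiv.swap 0 1 := by decide
  rcases hperm σ with rfl | rfl
  · exact congrArg g (Subtype.ext h.symm)
  · rw [show β' = x.swap.tuple from Subtype.ext (h.trans x.tuple_swap.symm), hg, hg, hf]

theorem lift_relM {f : Gen A → N} (hf : IsSymbol f) {g : GenTuple 2 A → N}
    (hg : ∀ x : Gen A, g x.tuple = f x) {r : FreeAbelianGroup (GenTuple 2 A)}
    (hr : r ∈ relM 2 A) : FreeAbelianGroup.lift g r = 0 := by
  obtain ⟨_, β, β₁, β₂, h₁, h₂, rfl⟩ := hr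
  obtain ⟨x, rfl⟩ := tuple_surjective β
  rw [show β₁ = x.subFst.tuple from Subtype.ext (h₁.trans x.tuple_subFst.symm),
    show β₂ = x.subSnd.tuple from Subtype.ext (h₂.trans x.tuple_subSnd.symm)]
  simp only [map_sub, FreeAbelianGroup.lift_apply_of, hg]
  rw [hf.eq_add]
  abel

theorem lift_relA {f : Gen A → N} (hf : ∀ x, f x.flip = -f x) {g : GenTuple 2 A → N}
    (hg : ∀ x : Gen A, g x.tuple = f x) {r : FreeAbelianGroup (GenTuple 2 A)}
    (hr : r ∈ relA 2 A) : FreeAbelianGroup.lift g r = 0 := by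
  obtain ⟨_, β, β', h, rfl⟩ := hr
  obtain ⟨x, rfl⟩ := tuple_surjective β
  rw [show β' = x.flip.tuple from Subtype.ext (h.trans x.tuple_flip.symm)]
  simp only [map_add, FreeAbelianGroup.lift_apply_of, hg, hf, add_neg_cancel]

theorem quotient_eq_zero {X : Type} {S : Set (FreeAbelianGroup X)} {r : FreeAbelianGroup X}
    (hr : r ∈ S) : (QuotientAddGroup.mk r : FreeAbelianGroup X ⧸ AddSubgroup.closure S) = 0 :=
  (QuotientAddGroup.eq_zero_iff r).2 (AddSubgroup.subset_closure hr)

theorem quotient_hom_ext {X : Type} {S : Set (FreeAbelianGroup X)}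
    {φ ψ : FreeAbelianGroup X ⧸ AddSubgroup.closure S →+ N}
    (h : ∀ x, φ (QuotientAddGroup.mk (FreeAbelianGroup.of x)) =
      ψ (QuotientAddGroup.mk (FreeAbelianGroup.of x))) : φ = ψ :=
  QuotientAddGroup.addMonoidHom_ext _ (FreeAbelianGroup.lift_ext _ _ h)

theorem Mn.hom_ext {φ ψ : Mn 2 A →+ N} (h : ∀ x : Gen A, φ (symb 2 A x.tuple) =
    ψ (symb 2 A x.tuple)) : φ = ψ :=
  quotient_hom_ext (tuple_surjective.forall.2 h)

theorem MnMinus.hom_ext {φ ψ : MnMinus 2 A →+ N} (h : ∀ x : Gen A, φ (symbm 2 A x.tuple) =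
    ψ (symbm 2 A x.tuple)) : φ = ψ :=
  quotient_hom_ext (tuple_surjective.forall.2 h)

theorem Mn.exists_hom {f : Gen A → N} (hf : IsSymbol f) :
    ∃ φ : Mn 2 A →+ N, ∀ x : Gen A, φ (symb 2 A x.tuple) = f x := by
  obtain ⟨g, hg⟩ := exists_tuple_function f
  obtain ⟨φ, hφ⟩ := exists_quotient_hom (S := relO 2 A ∪ relM 2 A) g (by
    rintro r (hr | hr)
    exacts [lift_relO hf.swap hg hr, lift_relM hf hg hr])
  exact ⟨φ, fun x ↦ (hφ x.tuple).trans (hg x)⟩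

theorem MnMinus.exists_hom {f : Gen A → N} (hf : IsEdge f) (hd : ∀ x, tri f x = 0) :
    ∃ φ : MnMinus 2 A →+ N, ∀ x : Gen A, φ (symbm 2 A x.tuple) = f x := by
  obtain ⟨g, hg⟩ := exists_tuple_function f
  obtain ⟨φ, hφ⟩ := exists_quotient_hom (S := relO 2 A ∪ relM 2 A ∪ relA 2 A) g (by
    rintro r ((hr | hr) | hr)
    exacts [lift_relO hf.swap hg hr, lift_relM (hf.isSymbol_iff.2 hd) hg hr,
      lift_relA hf.flip hg hr])
  exact ⟨φ, fun x ↦ (hφ x.tuple).trans (hg x)⟩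

theorem Mn.isSymbol_symb : IsSymbol fun x : Gen A ↦ symb 2 A x.tuple := by
  refine ⟨fun x ↦ ?_, fun x ↦ ?_⟩
  · have h := quotient_eq_zero (S := relO 2 A ∪ relM 2 A)
      (.inl ⟨x.tuple, x.swap.tuple, _, x.tuple_swap, rfl⟩)
    exact (sub_eq_zero.1 h).symm
  · have h := quotient_eq_zero (S := relO 2 A ∪ relM 2 A)
      (.inr ⟨le_rfl, x.tuple, x.subFst.tuple, x.subSnd.tuple, x.tuple_subFst, x.tuple_subSnd, rfl⟩)
    change symb 2 A _ - symb 2 A _ - symb 2 A _ = 0 at h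
    linear_combination (norm := abel) h

theorem MnMinus.isSymbol_symbm : IsSymbol fun x : Gen A ↦ symbm 2 A x.tuple := by
  refine ⟨fun x ↦ ?_, fun x ↦ ?_⟩
  · exact congrArg (toMinus 2 A) (Mn.isSymbol_symb.swap x)
  · exact (congrArg (toMinus 2 A) (Mn.isSymbol_symb.eq_add x)).trans (map_add _ _ _)

theorem MnMinus.isEdge_symbm : IsEdge fun x : Gen A ↦ symbm 2 A x.tuple := by
  refine ⟨isSymbol_symbm.swap, fun x ↦ ?_⟩
  have h := quotient_eq_zero (S := relO 2 A ∪ relM 2 A ∪ relA 2 A)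
    (.inr ⟨one_le_two, x.tuple, x.flip.tuple, x.tuple_flip, rfl⟩)
  exact eq_neg_of_add_eq_zero_right h

theorem IsSymbol.comp {f : Gen A → N} (hf : IsSymbol f) {N' : Type} [AddCommGroup N']
    (φ : N →+ N') : IsSymbol fun x ↦ φ (f x) :=
  ⟨fun x ↦ by rw [hf.swap], fun x ↦ by rw [hf.eq_add, map_add]⟩

theorem IsEdge.comp {f : Gen A → N} (hf : IsEdge f) {N' : Type} [AddCommGroup N']
    (φ : N →+ N') : IsEdge fun x ↦ φ (f x) :=
  ⟨fun x ↦ by rw [hf.swap], fun x ↦ by rw [hf.flip, map_neg]⟩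

theorem MnMinus.isEdge_comp (φ : MnMinus 2 A →+ N) :
    IsEdge fun x : Gen A ↦ φ (symbm 2 A x.tuple) := isEdge_symbm.comp φ

theorem MnMinus.tri_comp (φ : MnMinus 2 A →+ N) (x : Gen A) :
    tri (fun x : Gen A ↦ φ (symbm 2 A x.tuple)) x = 0 :=
  (isEdge_comp φ).isSymbol_iff.1 (isSymbol_symbm.comp φ) x

variable (A) (R : Type) [CommRing R]

/-- The module of functions on generating pairs which define homomorphisms on `M₂(A)`. -/
def symbolFunctions : Submodule R (Gen A → R) where
  carrier := {f | IsSymbol f}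
  add_mem' {f g} hf hg := ⟨fun x ↦ by simp [hf.swap, hg.swap],
    fun x ↦ by rw [Pi.add_apply, hf.eq_add, hg.eq_add]; exact add_add_add_comm _ _ _ _⟩
  zero_mem' := ⟨fun _ ↦ rfl, fun _ ↦ by simp⟩
  smul_mem' c f hf := ⟨fun x ↦ by simp [hf.swap], fun x ↦ by
    rw [Pi.smul_apply, hf.eq_add]; exact smul_add _ _ _⟩

/-- Homomorphisms on `M₂(A)` as functions on generating pairs. -/
noncomputable def Mn.homEquiv : (Mn 2 A →+ R) ≃ₗ[R] symbolFunctions A R :=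
  LinearEquiv.ofBijective
    { toFun := fun φ ↦ ⟨fun x ↦ φ (symb 2 A x.tuple), isSymbol_symb.comp φ⟩
      map_add' := fun _ _ ↦ rfl
      map_smul' := fun _ _ ↦ rfl }
    ⟨fun _ _ h ↦ hom_ext fun x ↦ congrFun (congrArg Subtype.val h) x, fun f ↦ by
      obtain ⟨φ, hφ⟩ := exists_hom f.2
      exact ⟨φ, Subtype.ext (funext hφ)⟩⟩

/-- Homomorphisms on `M₂⁻(A)` as functions on generating pairs. -/
noncomputable def MnMinus.homEquiv :
    (MnMinus 2 A →+ R) ≃ₗ[R] LinearMap.ker (coboundary A R) :=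
  LinearEquiv.ofBijective
    { toFun := fun φ ↦ ⟨⟨fun x ↦ φ (symbm 2 A x.tuple), isEdge_comp φ⟩, by
        ext o
        induction o using Quotient.inductionOn with | _ x
        exact tri_comp φ x⟩
      map_add' := fun _ _ ↦ rfl
      map_smul' := fun _ _ ↦ rfl }
    ⟨fun _ _ h ↦ hom_ext fun x ↦ congrFun (congrArg (fun z ↦ z.1.1) h) x, fun f ↦
      (exists_hom f.1.2 fun x ↦ congrFun f.2 ⟦x⟧).imp fun _ hφ ↦
        Subtype.ext (Subtype.ext (funext hφ))⟩

instance [Finite A] : Finite (GenTuple 2 A) :=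
  inferInstanceAs (Finite {_b : Fin 2 → A // _})

theorem addGroup_fg_quotient {X : Type} [Finite X] (S : AddSubgroup (FreeAbelianGroup X)) :
    AddGroup.FG (FreeAbelianGroup X ⧸ S) :=
  have : AddGroup.FG (FreeAbelianGroup X) := AddGroup.fg_iff_addMonoid_fg.2 inferInstance
  inferInstance

instance [Finite A] : Module.Finite ℤ (MnMinus 2 A) :=
  Module.Finite.iff_addGroup_fg.2
    (addGroup_fg_quotient _)

end Hom

end KPT

namespace KPT

open TensorProduct

theorem finrank_tensor_eq_finrank_hom (M : Type) [AddCommGroup M] :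
    Module.finrank ℚ (ℚ ⊗[ℤ] M) = Module.finrank ℚ (M →+ ℚ) := by
  rw [← Subspace.dual_finrank_eq]
  exact ((addMonoidHomLequivInt ℚ).trans (LinearMap.liftBaseChangeEquiv ℚ)).finrank_eq.symm

/-- Additive maps to the field with two elements are linear. -/
def intLinearEquivDual (T : Type) [AddCommGroup T] [Module (ZMod 2) T] :
    (T →ₗ[ℤ] ZMod 2) ≃ₗ[ZMod 2] Module.Dual (ZMod 2) T where
  toFun f := f.toAddMonoidHom.toZModLinearMap 2
  map_add' _ _ := rfl
  map_smul' _ _ := rfl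
  invFun f := f.toAddMonoidHom.toIntLinearMap
  left_inv _ := rfl
  right_inv _ := rfl

theorem torsion_equiv_of_finrank_hom {M : Type} [AddCommGroup M] [Module.Finite ℤ M]
    (h2 : ∀ m ∈ AddCommGroup.torsion M, m + m = 0) {r k : ℕ}
    (hr : Module.finrank ℚ (M →+ ℚ) = r)
    (hk : Module.finrank (ZMod 2) (M →+ ZMod 2) = r + k) :
    Nonempty (AddCommGroup.torsion M ≃+ (Fin k → ZMod 2)) := by
  let T := Submodule.torsion ℤ M
  have hT : T.toAddSubgroup = AddCommGroup.torsion M := Submodule.torsion_int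
  have h2T (t : T) : t + t = 0 :=
    Subtype.ext (h2 t.1 (hT ▸ (show t.1 ∈ T.toAddSubgroup from t.2)))
  let _ : Module (ZMod 2) T := AddCommGroup.zmodModule fun t ↦ by rw [two_nsmul, h2T]
  obtain ⟨n, b⟩ := Module.basisOfFiniteTypeTorsionFree' (R := ℤ) (M := M ⧸ T)
  have := Module.Projective.of_basis b
  obtain ⟨s, hs⟩ := Module.projective_lifting_property _ LinearMap.id T.mkQ_surjective
  let e : (T × (M ⧸ T)) ≃ₗ[ℤ] M := lequivProdOfRightSplitExact T.injective_subtype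
    (by rw [Submodule.range_subtype, Submodule.ker_mkQ]) hs
  have hom (R : Type) [CommRing R] : (M →+ R) ≃ₗ[R] (T →ₗ[ℤ] R) × (Fin n → R) :=
    (addMonoidHomLequivInt R).trans <| (e.symm.congrLeft R R).trans <|
      (LinearMap.coprodEquiv R).symm.trans ((LinearEquiv.refl _ _).prodCongr (b.constr R).symm)
  have : Module.Finite (ZMod 2) T := Module.Finite.of_restrictScalars_finite ℤ (ZMod 2) T
  have hsub : Subsingleton (T →ₗ[ℤ] ℚ) := ⟨fun f g ↦ by
    have hzero (f : T →ₗ[ℤ] ℚ) (t : T) : f t = 0 := by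
      have := congrArg f (h2T t)
      rw [map_add, map_zero] at this
      linarith
    ext t
    rw [hzero, hzero]⟩
  rw [(hom ℚ).finrank_eq, Module.finrank_prod, Module.finrank_zero_of_subsingleton,
    Module.finrank_fin_fun, zero_add] at hr
  have : Module.Finite (ZMod 2) (T →ₗ[ℤ] ZMod 2) :=
    Module.Finite.equiv (intLinearEquivDual T).symm
  rw [(hom (ZMod 2)).finrank_eq, Module.finrank_prod, (intLinearEquivDual T).finrank_eq,
    Subspace.dual_finrank_eq, Module.finrank_fin_fun] at hk
  have e' : T ≃ₗ[ZMod 2] (Fin k → ZMod 2) :=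
    LinearEquiv.ofFinrankEq _ _ (by rw [Module.finrank_fin_fun]; lia)
  exact ⟨(AddEquiv.addSubgroupCongr hT.symm).trans e'.toAddEquiv⟩

end KPT

namespace KPT

open TensorProduct

variable {A : Type} [AddCommGroup A] [Finite A] {C : Type} {κ : Gen A → C}

theorem Nondegenerate.finrank_MnMinus (hA : Nondegenerate A) (hκ : IsComponentMap κ) :
    24 * Module.finrank ℚ (ℚ ⊗[ℤ] MnMinus 2 A) + 6 * Nat.card {x : Gen A // x.fst + x.fst = 0} =
      Nat.card (Gen A) + 24 * Nat.card C := by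
  have h₁ := hA.finrank_ker_coboundary_rat hκ
  rw [← (MnMinus.homEquiv A ℚ).finrank_eq, ← finrank_tensor_eq_finrank_hom] at h₁
  have h₂ := hA.card_triangles
  have h₃ := hA.card_regularEdges
  lia

theorem Nondegenerate.add_self_eq_zero_of_mem_torsion (hA : Nondegenerate A)
    (hκ : IsComponentMap κ) {m : MnMinus 2 A} (hm : m ∈ AddCommGroup.torsion (MnMinus 2 A)) :
    m + m = 0 := by
  refine CharacterModule.eq_zero_of_character_apply fun f ↦ ?_
  obtain ⟨F, hF, hdF, hπF⟩ := hA.exists_lift hκ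
    (QuotientAddGroup.mk' (AddSubgroup.zmultiples (1 : ℚ)))
    (QuotientAddGroup.mk'_surjective _)
    (fun q ↦ by
      rw [QuotientAddGroup.mk'_apply, QuotientAddGroup.eq_zero_iff, AddSubgroup.mem_zmultiples_iff]
      simp)
    (MnMinus.isEdge_comp f) (MnMinus.tri_comp f)
  obtain ⟨φ, hφ⟩ := MnMinus.exists_hom hF hdF
  have h : f + f = (QuotientAddGroup.mk' (AddSubgroup.zmultiples (1 : ℚ))).comp φ :=
    MnMinus.hom_ext fun x ↦ by
      rw [AddMonoidHom.comp_apply, hφ, hπF]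
      rfl
  obtain ⟨n, hn, hnm⟩ := isOfFinAddOrder_iff_nsmul_eq_zero.1 hm
  have h₀ : φ m = 0 := by
    have := congrArg φ hnm
    rw [map_nsmul, map_zero] at this
    exact (smul_eq_zero.1 this).resolve_left hn.ne'
  rw [map_add]
  refine (DFunLike.congr_fun h m).trans ?_
  exact (congrArg (QuotientAddGroup.mk' (AddSubgroup.zmultiples (1 : ℚ))) h₀).trans (map_zero _)

theorem Nondegenerate.torsion_MnMinus (hA : Nondegenerate A) (hκ : IsComponentMap κ)
    (hc : ∀ x y, κ x = κ y) {x : Gen A} (hx : x.fst + x.fst = 0) {k : ℕ}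
    (hk : 2 * (k + 1) = Nat.card {x : Gen A // x.fst + x.fst = 0}) :
    Nonempty (AddCommGroup.torsion (MnMinus 2 A) ≃+ (Fin k → ZMod 2)) := by
  refine torsion_equiv_of_finrank_hom (fun m hm ↦ hA.add_self_eq_zero_of_mem_torsion hκ hm) rfl ?_
  have h₁ := hA.finrank_ker_coboundary_rat hκ
  have h₂ := hA.finrank_ker_coboundary_zmod_two hκ hc hx
  rw [← (MnMinus.homEquiv A _).finrank_eq] at h₁ h₂
  have hC : Nat.card C = 1 := by
    have : Subsingleton C := ⟨hκ.surj.forall₂.2 hc⟩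
    have : Nonempty C := ⟨κ x⟩
    exact Nat.card_eq_one_iff_unique.2 ⟨inferInstance, inferInstance⟩
  have h₃ := hA.card_edges
  have h₄ := hA.card_regularEdges
  lia

end KPT

namespace KPT

open Gen TensorProduct

variable {A : Type} [AddCommGroup A]

section SignSum

variable {f : Gen A → ℚ}

theorem IsSymbol.add_neg (hf : IsSymbol f) : IsSymbol fun x ↦ f x + f x.neg := by
  refine ⟨fun x ↦ by rw [hf.swap, ← swap_neg, hf.swap], fun x ↦ ?_⟩
  have h₁ : x.neg.subFst = x.subFst.neg := by ext <;> simp; abel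
  have h₂ : x.neg.subSnd = x.subSnd.neg := by ext <;> simp; abel
  rw [hf.eq_add x, hf.eq_add x.neg, h₁, h₂]
  ring

theorem IsSymbol.flip_eq (hf : IsSymbol f) (hn : ∀ x, f x.neg = f x) (x : Gen A) :
    f x.flip = f x.rot + f x.rot.rot := by
  have h₁ : x.flip.neg.subFst = x.rot.neg.swap := by ext <;> simp [add_comm]
  have h₂ : x.flip.neg.subSnd = x.rot.rot.swap := by ext <;> simp <;> abel
  rw [← hn x.flip, hf.eq_add, h₁, h₂, hf.swap, hf.swap, hn]

theorem sum_rot [Finite A] (g : Gen A → ℚ) : ∑ x : Gen A, g x.rot = ∑ x, g x :=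
  (Function.bijective_iff_has_inverse.2 ⟨fun x : Gen A ↦ x.rot.rot, rot_rot_rot,
    rot_rot_rot⟩).sum_comp g

theorem sum_flip [Finite A] (g : Gen A → ℚ) : ∑ x : Gen A, g x.flip = ∑ x, g x :=
  (Function.Involutive.bijective (Gen.flip_flip (A := A))).sum_comp g

theorem IsSymbol.add_flip_eq_zero [Finite A] (hf : IsSymbol f) (hn : ∀ x, f x.neg = f x)
    (x : Gen A) : f x + f x.flip = 0 := by
  let F : Gen A → ℚ := fun x ↦ f x + f x.flip
  have htri (x) : F x = tri f x := by
    simp only [F, hf.flip_eq hn, tri]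
    ring
  have hflip (x) : F x.flip = F x := by simp only [F, Gen.flip_flip, add_comm]
  have hrot (x) : F x.rot = F x := by rw [htri, tri_rot, htri]
  have h₁ : ∑ x, F x * F x = ∑ x, F x * f x + ∑ x, F x * f x := by
    have h₃ := sum_flip fun x ↦ F x * f x
    simp only [hflip] at h₃
    nth_rw 2 [← h₃]
    rw [← Finset.sum_add_distrib]
    exact Finset.sum_congr rfl fun x _ ↦ mul_add _ _ _
  have h₂ : ∑ x, F x * F x = ∑ x, F x * f x + ∑ x, F x * f x + ∑ x, F x * f x := by
    have h₃ := sum_rot fun x ↦ F x * f x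
    have h₄ := sum_rot fun x ↦ F x.rot * f x.rot
    simp only [hrot] at h₃ h₄
    calc
      _ = ∑ x, (F x * f x + F x * f x.rot + F x * f x.rot.rot) :=
        Finset.sum_congr rfl fun x _ ↦ by rw [← mul_add, ← mul_add, ← tri, ← htri]
      _ = _ := by rw [Finset.sum_add_distrib, Finset.sum_add_distrib, h₄, h₃]
  have h₅ : ∑ x, F x * F x = 0 := by linarith
  rw [Finset.sum_eq_zero_iff_of_nonneg fun x _ ↦ mul_self_nonneg (F x)] at h₅
  exact mul_self_eq_zero.1 (h₅ x (Finset.mem_univ x))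

end SignSum

variable (A) in
/-- Functions of a generating pair which are invariant under adding the second entry to the first
one and under changing the sign of the first entry, and are odd in the second entry. -/
def transvectionFunctions : Submodule ℚ (Gen A → ℚ) where
  carrier := {g | (∀ x, g x.subFst = g x) ∧ (∀ x, g x.flip = g x) ∧ ∀ x, g x.neg = -g x}
  add_mem' hf hg := ⟨fun x ↦ by simp [hf.1, hg.1], fun x ↦ by simp [hf.2.1, hg.2.1],
    fun x ↦ by simp [hf.2.2, hg.2.2, add_comm]⟩
  zero_mem' := ⟨fun _ ↦ rfl, fun _ ↦ rfl, fun _ ↦ by simp⟩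
  smul_mem' c f hf := ⟨fun x ↦ by simp [hf.1], fun x ↦ by simp [hf.2.1],
    fun x ↦ by simp [hf.2.2]⟩

theorem IsSymbol.add_flip_mem [Finite A] {f : Gen A → ℚ} (hf : IsSymbol f) :
    (fun x ↦ f x + f x.flip) ∈ transvectionFunctions A := by
  refine ⟨fun x ↦ ?_, fun x ↦ ?_, fun x ↦ ?_⟩
  · have h₁ := hf.eq_add x
    have h₂ := hf.eq_add x.subFst.flip.swap
    have h₃ : x.subFst.flip.swap.subFst = x.subSnd := by ext <;> simp
    have h₄ : x.subFst.flip.swap.subSnd = x.flip.swap := by ext <;> simp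
    rw [h₃, h₄, hf.swap, hf.swap] at h₂
    change f x.subFst + f x.subFst.flip = f x + f x.flip
    linarith
  · simp only [Gen.flip_flip, add_comm]
  · have := hf.add_neg.add_flip_eq_zero (fun x ↦ by rw [Gen.neg_neg, add_comm]) x
    change f x.neg + f x.neg.flip = -(f x + f x.flip)
    rw [flip_neg]
    linarith

variable (A) in
/-- The even part, with respect to the sign of the first entry, of a symbol function. -/
def evenPart [Finite A] : symbolFunctions A ℚ →ₗ[ℚ] transvectionFunctions A where
  toFun f := ⟨fun x ↦ f.1 x + f.1 x.flip, IsSymbol.add_flip_mem f.2⟩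
  map_add' f g := by
    ext x
    exact add_add_add_comm _ _ _ _
  map_smul' c f := by
    ext x
    exact (mul_add c _ _).symm

theorem evenPart_surjective [Finite A] : Function.Surjective (evenPart A) := by
  rintro ⟨g, hg₁, hg₂, hg₃⟩
  refine ⟨⟨fun x ↦ (g x + g x.swap) / 2, fun x ↦ ?_, fun x ↦ ?_⟩, ?_⟩
  · rw [swap_swap, add_comm]
  · have h₁ : x.subSnd.swap = x.swap.subFst := rfl
    have h₂ : x.subFst.swap = x.subSnd.flip.neg.subFst := by ext <;> simp
    rw [h₁, hg₁, hg₁, h₂, hg₁, hg₃, hg₂]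
    ring
  · ext x
    have h₁ : x.flip.swap = x.swap.flip.neg := by ext <;> simp
    change (g x + g x.swap) / 2 + (g x.flip + g x.flip.swap) / 2 = g x
    rw [h₁, hg₃, hg₂, hg₂]
    ring

theorem finrank_symbolFunctions [Finite A] :
    Module.finrank ℚ (symbolFunctions A ℚ) = Module.finrank ℚ (transvectionFunctions A) +
      Module.finrank ℚ (LinearMap.ker (coboundary A ℚ)) := by
  have h := (evenPart A).finrank_range_add_finrank_ker
  rw [LinearMap.range_eq_top.2 evenPart_surjective, finrank_top] at h
  rw [← h]
  refine congrArg _ (LinearEquiv.finrank_eq ?_)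
  have hf (f : LinearMap.ker (evenPart A)) : IsEdge f.1.1 := ⟨f.1.2.swap, fun x ↦
    eq_neg_of_add_eq_zero_right (congrFun (congrArg Subtype.val f.2) x)⟩
  exact
    { toFun := fun f ↦ ⟨⟨f.1.1, hf f⟩, by
        ext o
        induction o using Quotient.inductionOn with | _ x
        exact (hf f).isSymbol_iff.1 f.1.2 x⟩
      map_add' := fun _ _ ↦ rfl
      map_smul' := fun _ _ ↦ rfl
      invFun := fun f ↦ ⟨⟨f.1.1, f.1.2.isSymbol_iff.2 fun x ↦ congrFun f.2 ⟦x⟧⟩, by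
        ext x
        exact add_eq_zero_iff_eq_neg'.2 (f.1.2.flip x)⟩
      left_inv := fun _ ↦ rfl
      right_inv := fun _ ↦ rfl }

theorem finrank_Mn [Finite A] :
    Module.finrank ℚ (ℚ ⊗[ℤ] Mn 2 A) = Module.finrank ℚ (transvectionFunctions A) +
      Module.finrank ℚ (ℚ ⊗[ℤ] MnMinus 2 A) := by
  rw [finrank_tensor_eq_finrank_hom, finrank_tensor_eq_finrank_hom,
    (Mn.homEquiv A ℚ).finrank_eq, (MnMinus.homEquiv A ℚ).finrank_eq, finrank_symbolFunctions]

end KPT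

namespace KPT

section Transvection

variable {A : Type} [AddCommGroup A]

/-- The pair `(a + k b, b)`. -/
def Gen.addFst (k : ℤ) (x : Gen A) : Gen A :=
  ⟨(x.fst + k • x.snd, x.snd), closure_eq_top_of_combination x.2 (a := 1) (b := -k) (c := 0)
    (d := 1) (by module) (by module)⟩

/-- The pair `(a, b + k a)`. -/
def Gen.addSnd (k : ℤ) (x : Gen A) : Gen A :=
  ⟨(x.fst, x.snd + k • x.fst), closure_eq_top_of_combination x.2 (a := 1) (b := 0) (c := -k)
    (d := 1) (by module) (by module)⟩

@[simp] theorem Gen.fst_addFst (k : ℤ) (x : Gen A) : (x.addFst k).fst = x.fst + k • x.snd := rfl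
@[simp] theorem Gen.snd_addFst (k : ℤ) (x : Gen A) : (x.addFst k).snd = x.snd := rfl
@[simp] theorem Gen.fst_addSnd (k : ℤ) (x : Gen A) : (x.addSnd k).fst = x.fst := rfl
@[simp] theorem Gen.snd_addSnd (k : ℤ) (x : Gen A) : (x.addSnd k).snd = x.snd + k • x.fst := rfl

theorem Gen.rel_addFst {R : Gen A → Gen A → Prop} (hR : Equivalence R)
    (h : ∀ x : Gen A, R x x.subFst) (k : ℤ) (x : Gen A) : R x (x.addFst k) := by
  have hsub (k : ℤ) : (x.addFst k).subFst = x.addFst (k - 1) :=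
    Gen.ext (by simp only [fst_subFst, fst_addFst, snd_addFst]; module) rfl
  induction k with
  | zero =>
    rw [show x.addFst 0 = x from Gen.ext (by simp) rfl]
    exact hR.refl x
  | succ k ih =>
    have := h (x.addFst (k + 1))
    rw [hsub, add_sub_cancel_right] at this
    exact hR.trans ih (hR.symm this)
  | pred k ih => exact hR.trans ih (hsub (-k) ▸ h _)

/-- Equivalence relations on generating pairs which are compatible with the moves of the complex
of triangles and edges. -/
structure IsConnection (R : Gen A → Gen A → Prop) : Prop extends Equivalence R where
  swap : ∀ x, R x x.swap
  rot : ∀ x, R x x.rot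
  flip : ∀ x, R x x.flip

variable {R : Gen A → Gen A → Prop}

theorem IsConnection.addFst (hR : IsConnection R) (k : ℤ) (x : Gen A) : R x (x.addFst k) := by
  refine Gen.rel_addFst hR.toEquivalence (fun x ↦ ?_) k x
  have : x.subFst = x.flip.rot.swap := by ext <;> simp
  rw [this]
  exact hR.trans (hR.flip x) (hR.trans (hR.rot _) (hR.swap _))

theorem IsConnection.addSnd (hR : IsConnection R) (k : ℤ) (x : Gen A) : R x (x.addSnd k) :=
  hR.trans (hR.swap x) (hR.trans (hR.addFst k _) (hR.swap _))

end Transvection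

theorem zsmul_fst_eq_mul {m n : ℕ} (k : ℤ) (v : ZMod m × ZMod n) : (k • v).1 = k * v.1 := by
  rw [Prod.smul_fst, zsmul_eq_mul]

theorem zsmul_snd_eq_mul {m n : ℕ} (k : ℤ) (v : ZMod m × ZMod n) : (k • v).2 = k * v.2 := by
  rw [Prod.smul_snd, zsmul_eq_mul]

section Half

variable {B : Type} [AddCommGroup B] {σ : B → ℤ}

theorem IsSign.eq_one_or (hσ : IsSign σ) (a : B) : σ a = 1 ∨ σ a = -1 :=
  mul_self_eq_one_iff.1 (hσ.mul_self a)

/-- The nonzero elements with positive sign. -/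
abbrev Half (σ : B → ℤ) : Type := {a : B // a ≠ 0 ∧ σ a = 1}

theorem IsSign.neg_of_ne_zero (hB : ∀ a : B, a + a = 0 → a = 0) (hσ : IsSign σ)
    {a : B} (ha : a ≠ 0) : σ (-a) = -σ a :=
  hσ.neg a fun h ↦ ha (hB a h)

theorem IsSign.smul_self_mem (hB : ∀ a : B, a + a = 0 → a = 0) (hσ : IsSign σ)
    {a : B} (ha : a ≠ 0) : σ a • a ≠ 0 ∧ σ (σ a • a) = 1 := by
  rcases hσ.eq_one_or a with h | h
  · simp [h, ha]
  · simp [h, ha, hσ.neg_of_ne_zero hB ha]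

/-- The element with positive sign among `a` and `-a`. -/
def IsSign.toHalf (hB : ∀ a : B, a + a = 0 → a = 0) (hσ : IsSign σ) (a : {a : B // a ≠ 0}) :
    Half σ :=
  ⟨σ a.1 • a.1, hσ.smul_self_mem hB a.2⟩

theorem IsSign.toHalf_of_half (hB : ∀ a : B, a + a = 0 → a = 0) (hσ : IsSign σ) (a : Half σ) :
    hσ.toHalf hB ⟨a.1, a.2.1⟩ = a :=
  Subtype.ext (by simp [toHalf, a.2.2])

theorem IsSign.toHalf_eq_iff (hB : ∀ a : B, a + a = 0 → a = 0) (hσ : IsSign σ)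
    {a b : {a : B // a ≠ 0}} :
    hσ.toHalf hB a = hσ.toHalf hB b ↔ a.1 = b.1 ∨ a.1 = -b.1 := by
  rw [Subtype.ext_iff]
  change σ a.1 • a.1 = σ b.1 • b.1 ↔ _
  constructor
  · rcases hσ.eq_one_or a.1 with h | h <;> rcases hσ.eq_one_or b.1 with h' | h' <;>
      simp +contextual [h, h', neg_eq_iff_eq_neg]
  · rintro (h | h)
    · rw [h]
    · rw [h, hσ.neg_of_ne_zero hB b.2, smul_neg, neg_smul, neg_neg]

theorem IsSign.card_half [Finite B] (hB : ∀ a : B, a + a = 0 → a = 0) (hσ : IsSign σ) :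
    2 * Nat.card (Half σ) + 1 = Nat.card B := by
  let e : Option (Half σ ⊕ Half σ) → B := fun o ↦ o.elim 0 (Sum.elim (fun a ↦ a.1) fun a ↦ -a.1)
  have he : Function.Bijective e := by
    refine ⟨?_, fun a ↦ ?_⟩
    · have hne (a b : Half σ) : a.1 ≠ -b.1 := fun h ↦ by
        have := a.2.2
        rw [h, hσ.neg_of_ne_zero hB b.2.1, b.2.2] at this
        exact absurd this (by decide)
      rintro (_ | a | a) (_ | b | b) h
      · rfl
      · exact absurd h.symm b.2.1
      · exact absurd h.symm (neg_ne_zero.2 b.2.1)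
      · exact absurd h a.2.1
      · exact congrArg (some ∘ Sum.inl) (Subtype.ext h)
      · exact absurd h (hne a b)
      · exact absurd h (neg_ne_zero.2 a.2.1)
      · exact absurd h.symm (hne b a)
      · exact congrArg (some ∘ Sum.inr) (Subtype.ext (neg_injective h))
    · by_cases ha : a = 0
      · exact ⟨none, ha.symm⟩
      rcases hσ.eq_one_or a with h | h
      · exact ⟨some (.inl ⟨a, ha, h⟩), rfl⟩
      · refine ⟨some (.inr ⟨-a, neg_ne_zero.2 ha, ?_⟩), neg_neg a⟩
        rw [hσ.neg_of_ne_zero hB ha, h, neg_neg]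
  rw [← Nat.card_congr (Equiv.ofBijective e he), Finite.card_option, Nat.card_sum, two_mul]

end Half

end KPT

namespace KPT

open Gen TensorProduct

namespace Gen

variable {p : ℕ}

/-- The determinant of a pair of elements of `ℤ/p × ℤ/p`. -/
def det (x : Gen (ZMod p × ZMod p)) : ZMod p := x.fst.1 * x.snd.2 - x.fst.2 * x.snd.1

theorem det_swap (x : Gen (ZMod p × ZMod p)) : x.swap.det = -x.det := by
  simp only [det, fst_swap, snd_swap]; ring

theorem det_flip (x : Gen (ZMod p × ZMod p)) : x.flip.det = -x.det := by
  simp only [det, fst_flip, snd_flip, Prod.fst_neg, Prod.snd_neg]; ring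

theorem det_neg (x : Gen (ZMod p × ZMod p)) : x.neg.det = x.det := by
  simp only [det, fst_neg, snd_neg, Prod.fst_neg, Prod.snd_neg]; ring

theorem det_rot (x : Gen (ZMod p × ZMod p)) : x.rot.det = x.det := by
  simp only [det, fst_rot, snd_rot, Prod.fst_neg, Prod.snd_neg, Prod.fst_sub, Prod.snd_sub]; ring

theorem det_subFst (x : Gen (ZMod p × ZMod p)) : x.subFst.det = x.det := by
  simp only [det, fst_subFst, snd_subFst, Prod.fst_sub, Prod.snd_sub]; ring

theorem det_addFst (k : ℤ) (x : Gen (ZMod p × ZMod p)) : (x.addFst k).det = x.det := by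
  simp only [det, fst_addFst, snd_addFst, Prod.fst_add, Prod.snd_add, zsmul_fst_eq_mul,
    zsmul_snd_eq_mul]; ring

theorem det_addSnd (k : ℤ) (x : Gen (ZMod p × ZMod p)) : (x.addSnd k).det = x.det := by
  simp only [det, fst_addSnd, snd_addSnd, Prod.fst_add, Prod.snd_add, zsmul_fst_eq_mul,
    zsmul_snd_eq_mul]; ring

variable [Fact p.Prime]

theorem det_ne_zero (x : Gen (ZMod p × ZMod p)) : x.det ≠ 0 := fun h ↦ by
  obtain ⟨m, n, h₁⟩ := x.exists_combination (1, 0)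
  obtain ⟨m', n', h₂⟩ := x.exists_combination (0, 1)
  simp only [Prod.ext_iff, Prod.fst_add, Prod.snd_add, zsmul_fst_eq_mul,
    zsmul_snd_eq_mul] at h₁ h₂
  refine one_ne_zero (α := ZMod p) ?_
  unfold det at h
  linear_combination (-1 : ZMod p) * h₂.2 - (m' * x.fst.2 + n' * x.snd.2 : ZMod p) * h₁.1
    + (m' * x.fst.1 + n' * x.snd.1 : ZMod p) * h₁.2 + (m * n' - n * m' : ZMod p) * h

theorem closure_eq_top_of_det_ne_zero {u v : ZMod p × ZMod p} (h : u.1 * v.2 - u.2 * v.1 ≠ 0) :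
    AddSubgroup.closure {u, v} = ⊤ := by
  refine eq_top_iff.2 fun w _ ↦ AddSubgroup.mem_closure_pair.2 ?_
  obtain ⟨m, hm⟩ := ZMod.intCast_surjective ((w.1 * v.2 - w.2 * v.1) / (u.1 * v.2 - u.2 * v.1))
  obtain ⟨n, hn⟩ := ZMod.intCast_surjective ((u.1 * w.2 - u.2 * w.1) / (u.1 * v.2 - u.2 * v.1))
  refine ⟨m, n, ?_⟩
  ext
  · simp only [Prod.fst_add, zsmul_fst_eq_mul, hm, hn]
    rw [div_mul_eq_mul_div, div_mul_eq_mul_div, ← add_div, div_eq_iff h]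
    ring
  · simp only [Prod.snd_add, zsmul_snd_eq_mul, hm, hn]
    rw [div_mul_eq_mul_div, div_mul_eq_mul_div, ← add_div, div_eq_iff h]
    ring

/-- A pair with nonzero determinant generates. -/
def ofDet (u v : ZMod p × ZMod p) (h : u.1 * v.2 - u.2 * v.1 ≠ 0) : Gen (ZMod p × ZMod p) :=
  ⟨(u, v), closure_eq_top_of_det_ne_zero h⟩

theorem snd_ne_zero (x : Gen (ZMod p × ZMod p)) : x.snd ≠ 0 := fun h ↦ by
  have := x.det_ne_zero
  simp [det, h] at this

theorem exists_snd_det {v : ZMod p × ZMod p} (hv : v ≠ 0) {d : ZMod p} (hd : d ≠ 0) :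
    ∃ x : Gen (ZMod p × ZMod p), x.snd = v ∧ x.det = d := by
  by_cases h : v.1 = 0
  · have h' : v.2 ≠ 0 := fun h' ↦ hv (Prod.ext h h')
    have : d / v.2 * v.2 - 0 * v.1 = d := by field_simp; ring
    exact ⟨ofDet (d / v.2, 0) v (by rwa [this]), rfl, this⟩
  · have : 0 * v.2 - -d / v.1 * v.1 = d := by field_simp; ring
    exact ⟨ofDet (0, -d / v.1) v (by rwa [this]), rfl, this⟩

theorem exists_eq_addFst {x y : Gen (ZMod p × ZMod p)} (h : x.snd = y.snd) (hd : x.det = y.det) :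
    ∃ k : ℤ, y = x.addFst k := by
  have hk : ∃ k : ZMod p, y.fst.1 = x.fst.1 + k * x.snd.1 ∧ y.fst.2 = x.fst.2 + k * x.snd.2 := by
    unfold det at hd
    rw [← h] at hd
    by_cases h₁ : x.snd.1 = 0
    · have h₂ : x.snd.2 ≠ 0 := fun h' ↦ x.snd_ne_zero (Prod.ext h₁ h')
      refine ⟨(y.fst.2 - x.fst.2) / x.snd.2, ?_, by field_simp; ring⟩
      simp only [h₁, mul_zero, sub_zero, add_zero] at hd ⊢
      exact (mul_right_cancel₀ h₂ hd).symm
    · refine ⟨(y.fst.1 - x.fst.1) / x.snd.1, by field_simp; ring, ?_⟩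
      field_simp
      linear_combination hd
  obtain ⟨k, hk₁, hk₂⟩ := hk
  obtain ⟨k, rfl⟩ := ZMod.intCast_surjective k
  refine ⟨k, Gen.ext (Prod.ext ?_ ?_) h.symm⟩
  · rw [hk₁, fst_addFst, Prod.fst_add, zsmul_fst_eq_mul]
  · rw [hk₂, fst_addFst, Prod.snd_add, zsmul_snd_eq_mul]

theorem natCard_zmod_prod :
    Nat.card (Gen (ZMod p × ZMod p)) = (p ^ 2 - 1) * (p ^ 2 - p) := by
  let e : Gen (ZMod p × ZMod p) → GL (Fin 2) (ZMod p) := fun x ↦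
    Matrix.GeneralLinearGroup.mkOfDetNeZero !![x.fst.1, x.fst.2; x.snd.1, x.snd.2] (by
      rw [Matrix.det_fin_two_of]
      exact x.det_ne_zero)
  have he : Function.Bijective e := by
    refine ⟨fun x y h ↦ ?_, fun g ↦ ?_⟩
    · have h (i j) : (e x).1 i j = (e y).1 i j := by rw [h]
      exact Gen.ext (Prod.ext (h 0 0) (h 0 1)) (Prod.ext (h 1 0) (h 1 1))
    · refine ⟨ofDet (g.1 0 0, g.1 0 1) (g.1 1 0, g.1 1 1) ?_, ?_⟩
      · have := g.det_ne_zero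
        rwa [Matrix.det_fin_two] at this
      · ext i j
        fin_cases i <;> fin_cases j <;> rfl
  rw [Nat.card_congr (Equiv.ofBijective e he), Matrix.card_GL_field, Fin.prod_univ_two,
    ZMod.card]
  simp

end Gen

variable {p : ℕ} [Fact p.Prime]

theorem nondegenerate_zmod_prod (hp : ∀ a : ZMod p × ZMod p, a + a = 0 → a = 0) :
    Nondegenerate (ZMod p × ZMod p) := by
  refine fun x ↦ ⟨fun k h ↦ x.det_ne_zero ?_, fun h ↦ x.snd_ne_zero (hp _ h.2)⟩
  simp only [det, h, zsmul_fst_eq_mul, zsmul_snd_eq_mul]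
  ring

theorem IsConnection.of_det_eq {R : Gen (ZMod p × ZMod p) → Gen (ZMod p × ZMod p) → Prop}
    (hR : IsConnection R) {x y : Gen (ZMod p × ZMod p)} (h : x.det = y.det) : R x y := by
  have key (x : Gen (ZMod p × ZMod p)) :
      ∃ z, R x z ∧ z.det = x.det ∧ z.fst = (1, 0) ∧ z.snd.1 = 0 := by
    have h₁ : ∃ z, R x z ∧ z.det = x.det ∧ z.snd.1 ≠ 0 := by
      by_cases hx : x.snd.1 = 0
      · refine ⟨x.addSnd 1, hR.addSnd 1 x, det_addSnd 1 x, fun h ↦ x.det_ne_zero ?_⟩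
        simp only [snd_addSnd, one_smul, Prod.fst_add, hx, zero_add] at h
        simp [det, h, hx]
      · exact ⟨x, hR.refl x, rfl, hx⟩
    obtain ⟨z₁, hz₁, hd₁, hn⟩ := h₁
    obtain ⟨k, hk⟩ := ZMod.intCast_surjective ((1 - z₁.fst.1) / z₁.snd.1)
    have h₂ : (z₁.addFst k).fst.1 = 1 := by
      simp only [fst_addFst, Prod.fst_add, zsmul_fst_eq_mul, hk]
      field_simp
      ring
    obtain ⟨l, hl⟩ := ZMod.intCast_surjective (-(z₁.addFst k).snd.1)
    set z₂ := z₁.addFst k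
    have h₃ : (z₂.addSnd l).snd.1 = 0 := by
      simp only [snd_addSnd, Prod.fst_add, zsmul_fst_eq_mul, hl, h₂]
      ring
    have h₄ : (z₂.addSnd l).fst.1 = 1 := h₂
    set z₃ := z₂.addSnd l
    have hd₃ : z₃.det = x.det := by rw [det_addSnd, det_addFst, hd₁]
    have hn₃ : z₃.snd.2 ≠ 0 := fun h ↦ z₃.snd_ne_zero (Prod.ext h₃ h)
    obtain ⟨m, hm⟩ := ZMod.intCast_surjective (-z₃.fst.2 / z₃.snd.2)
    refine ⟨z₃.addFst m, hR.trans hz₁ (hR.trans (hR.addFst k _) (hR.trans (hR.addSnd l _)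
      (hR.addFst m _))), by rw [det_addFst, hd₃], Prod.ext ?_ ?_, h₃⟩
    · simpa [zsmul_fst_eq_mul, h₃] using h₄
    · simp only [fst_addFst, Prod.snd_add, zsmul_snd_eq_mul, hm]
      field_simp
      ring
  obtain ⟨z, hz, hzd, hz₁, hz₂⟩ := key x
  obtain ⟨w, hw, hwd, hw₁, hw₂⟩ := key y
  have : z = w := by
    refine Gen.ext (hz₁.trans hw₁.symm) (Prod.ext (hz₂.trans hw₂.symm) ?_)
    have : z.det = w.det := by rw [hzd, hwd, h]
    simpa [det, hz₁, hw₁] using this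
  exact hR.trans hz (this ▸ hR.symm hw)

section Component

variable {σ : ZMod p → ℤ} (hσ : IsSign σ) (hp : ∀ a : ZMod p, a + a = 0 → a = 0)

/-- The determinant up to sign. -/
def absDet (x : Gen (ZMod p × ZMod p)) : Half σ := hσ.toHalf hp ⟨x.det, x.det_ne_zero⟩

theorem absDet_eq_iff {x y : Gen (ZMod p × ZMod p)} :
    absDet hσ hp x = absDet hσ hp y ↔ x.det = y.det ∨ x.det = -y.det := hσ.toHalf_eq_iff hp

theorem isComponentMap_absDet : IsComponentMap (absDet hσ hp) := by
  refine ⟨fun d ↦ ?_, fun x ↦ (absDet_eq_iff hσ hp).2 (.inr x.det_swap),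
    fun x ↦ (absDet_eq_iff hσ hp).2 (.inl x.det_rot),
    fun x ↦ (absDet_eq_iff hσ hp).2 (.inr x.det_flip), fun R h hs hr hf x y hxy ↦ ?_⟩
  · obtain ⟨x, -, hx⟩ := exists_snd_det (v := (1, 0)) (by simp) d.2.1
    refine ⟨x, ?_⟩
    rw [← hσ.toHalf_of_half hp d]
    exact congrArg (hσ.toHalf hp) (Subtype.ext hx)
  · have hR : IsConnection R := ⟨h, hs, hr, hf⟩
    rcases (absDet_eq_iff hσ hp).1 hxy with h | h
    · exact hR.of_det_eq h
    · exact hR.trans (hR.of_det_eq (h.trans y.det_flip.symm)) (hR.symm (hf y))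

end Component

section TransvectionFunctions

theorem transvectionFunctions_apply_eq {g : Gen (ZMod p × ZMod p) → ℚ}
    (hg : g ∈ transvectionFunctions (ZMod p × ZMod p)) {x y : Gen (ZMod p × ZMod p)}
    (h : x.snd = y.snd) (hd : x.det = y.det) : g x = g y := by
  obtain ⟨k, rfl⟩ := exists_eq_addFst h hd
  exact rel_addFst (R := fun x y ↦ g x = g y) ⟨fun _ ↦ rfl, fun h ↦ h.symm, fun h h' ↦ h.trans h'⟩
    (fun x ↦ (hg.1 x).symm) k x

theorem finrank_transvectionFunctions {σ : ZMod p → ℤ} (hσ : IsSign σ)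
    (hp : ∀ a : ZMod p, a + a = 0 → a = 0) {τ : ZMod p × ZMod p → ℤ} (hτ : IsSign τ)
    (hp' : ∀ a : ZMod p × ZMod p, a + a = 0 → a = 0) :
    Module.finrank ℚ (transvectionFunctions (ZMod p × ZMod p)) =
      Nat.card (Half τ) * Nat.card (Half σ) := by
  choose s hs₁ hs₂ using fun i : Half τ × Half σ ↦ exists_snd_det i.1.2.1 i.2.2.1
  let L : transvectionFunctions (ZMod p × ZMod p) →ₗ[ℚ] (Half τ × Half σ → ℚ) :=
    { toFun := fun g i ↦ g.1 (s i)
      map_add' := fun _ _ ↦ rfl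
      map_smul' := fun _ _ ↦ rfl }
  have hL : Function.Bijective L := by
    constructor
    · refine (injective_iff_map_eq_zero L).2 fun g hg ↦ Subtype.ext (funext fun x ↦ ?_)
      have h₁ (x) (hx : τ x.snd = 1) (hx' : σ x.det = 1) : g.1 x = 0 := by
        let i : Half τ × Half σ := (⟨x.snd, x.snd_ne_zero, hx⟩, ⟨x.det, x.det_ne_zero, hx'⟩)
        rw [← transvectionFunctions_apply_eq g.2 (hs₁ i) (hs₂ i)]
        exact congrFun hg i
      have h₂ (x) (hx : τ x.snd = 1) : g.1 x = 0 := by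
        rcases hσ.eq_one_or x.det with h | h
        · exact h₁ x hx h
        · rw [← g.2.2.1 x]
          refine h₁ _ hx ?_
          rw [det_flip, hσ.neg_of_ne_zero hp x.det_ne_zero, h, _root_.neg_neg]
      rcases hτ.eq_one_or x.snd with h | h
      · exact h₂ x h
      · refine neg_eq_zero.1 ((g.2.2.2 x).symm.trans (h₂ _ ?_))
        rw [snd_neg, hτ.neg_of_ne_zero hp' x.snd_ne_zero, h, _root_.neg_neg]
    · intro h
      let g : Gen (ZMod p × ZMod p) → ℚ := fun x ↦
        τ x.snd * h (hτ.toHalf hp' ⟨x.snd, x.snd_ne_zero⟩, absDet hσ hp x)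
      refine ⟨⟨g, fun x ↦ ?_, fun x ↦ ?_, fun x ↦ ?_⟩, funext fun i ↦ ?_⟩
      · simp only [g, (absDet_eq_iff hσ hp).2 (.inl x.det_subFst), snd_subFst]
      · simp only [g, (absDet_eq_iff hσ hp).2 (.inr x.det_flip), snd_flip]
      · simp only [g, (absDet_eq_iff hσ hp).2 (.inl x.det_neg), snd_neg,
          hτ.neg_of_ne_zero hp' x.snd_ne_zero]
        rw [(hτ.toHalf_eq_iff hp' (a := ⟨-x.snd, _⟩) (b := ⟨x.snd, x.snd_ne_zero⟩)).2 (.inr rfl)]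
        push_cast
        ring
      · change (τ (s i).snd : ℚ) * h (hτ.toHalf hp' ⟨(s i).snd, _⟩, absDet hσ hp (s i)) = h i
        have h₁ : hτ.toHalf hp' ⟨(s i).snd, (s i).snd_ne_zero⟩ = i.1 := by
          rw [← hτ.toHalf_of_half hp' i.1]
          exact congrArg (hτ.toHalf hp') (Subtype.ext (hs₁ i))
        have h₂ : absDet hσ hp (s i) = i.2 := by
          rw [← hσ.toHalf_of_half hp i.2]
          exact congrArg (hσ.toHalf hp) (Subtype.ext (hs₂ i))
        rw [h₁, h₂, hs₁, i.1.2.2, Int.cast_one, one_mul]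
  have := Fintype.ofFinite (Half τ × Half σ)
  rw [(LinearEquiv.ofBijective L hL).finrank_eq, Module.finrank_fintype_fun_eq_card,
    ← Nat.card_eq_fintype_card, Nat.card_prod]

end TransvectionFunctions

theorem finrank_zmod_prod (hp : Odd p) :
    24 * Module.finrank ℚ (ℚ ⊗[ℤ] MnMinus 2 (ZMod p × ZMod p)) =
      (p ^ 2 - 1) * (p ^ 2 - p) + 12 * (p - 1) ∧
    4 * Module.finrank ℚ (ℚ ⊗[ℤ] Mn 2 (ZMod p × ZMod p)) =
      (p ^ 2 - 1) * (p - 1) +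
        4 * Module.finrank ℚ (ℚ ⊗[ℤ] MnMinus 2 (ZMod p × ZMod p)) := by
  have h₁ (a : ZMod p) (ha : a + a = 0) : a = 0 := by
    have := ZMod.add_self_eq_zero_iff_eq_zero hp (a := a)
    exact this.1 ha
  have h₂ (a : ZMod p × ZMod p) (ha : a + a = 0) : a = 0 :=
    Prod.ext (h₁ _ (congrArg Prod.fst ha)) (h₁ _ (congrArg Prod.snd ha))
  obtain ⟨σ, hσ⟩ := exists_isSign (ZMod p)
  obtain ⟨τ, hτ⟩ := exists_isSign (ZMod p × ZMod p)
  have hc₁ := hσ.card_half h₁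
  have hc₂ := hτ.card_half h₂
  have hm := (nondegenerate_zmod_prod h₂).finrank_MnMinus (isComponentMap_absDet hσ h₁)
  have : IsEmpty {x : Gen (ZMod p × ZMod p) // x.fst + x.fst = 0} :=
    ⟨fun x ↦ x.1.swap.snd_ne_zero (h₂ _ x.2)⟩
  rw [Nat.card_of_isEmpty, natCard_zmod_prod] at hm
  rw [finrank_Mn, finrank_transvectionFunctions hσ h₁ hτ h₂]
  rw [Nat.card_prod, Nat.card_zmod] at hc₂
  rw [Nat.card_zmod] at hc₁
  have hs : p ^ 2 - 1 = 2 * Nat.card (Half τ) := by rw [pow_two]; lia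
  have hs' : p - 1 = 2 * Nat.card (Half σ) := by lia
  constructor
  · lia
  · rw [hs, hs']
    ring

end KPT

namespace KPT

/-- The pairs of coprime elements of a ring. -/
abbrev CoprimePair (R : Type) [CommRing R] : Type := {x : R × R // IsCoprime x.1 x.2}

section CoprimePair

theorem natCard_coprimePair_congr {R S : Type} [CommRing R] [CommRing S] (e : R ≃+* S) :
    Nat.card (CoprimePair R) = Nat.card (CoprimePair S) :=
  Nat.card_congr ((e.toEquiv.prodCongr e.toEquiv).subtypeEquiv fun x ↦
    ⟨fun h ↦ h.map e.toRingHom, fun h ↦ by simpa using h.map e.symm.toRingHom⟩)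

theorem natCard_coprimePair_prod (R S : Type) [CommRing R] [CommRing S] :
    Nat.card (CoprimePair (R × S)) = Nat.card (CoprimePair R) * Nat.card (CoprimePair S) := by
  rw [← Nat.card_prod]
  refine Nat.card_congr
    { toFun := fun x ↦ (⟨(x.1.1.1, x.1.2.1), x.2.map (RingHom.fst R S)⟩,
        ⟨(x.1.1.2, x.1.2.2), x.2.map (RingHom.snd R S)⟩)
      invFun := fun x ↦ ⟨((x.1.1.1, x.2.1.1), (x.1.1.2, x.2.1.2)), ?_⟩
      left_inv := fun _ ↦ rfl
      right_inv := fun _ ↦ rfl }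
  obtain ⟨⟨x₁, a, b, h⟩, ⟨x₂, a', b', h'⟩⟩ := x
  exact ⟨(a, a'), (b, b'), Prod.ext h h'⟩

theorem natCard_isUnit (n : ℕ) [NeZero n] : Nat.card {d : ZMod n // IsUnit d} = n.totient := by
  rw [← Nat.card_congr (Equiv.ofBijective
    (fun u : (ZMod n)ˣ ↦ (⟨u, u.isUnit⟩ : {d : ZMod n // IsUnit d}))
    ⟨fun u v h ↦ Units.ext (congrArg Subtype.val h), fun d ↦ ⟨d.2.unit, rfl⟩⟩),
    Nat.card_eq_fintype_card,
    ZMod.card_units_eq_totient]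

theorem castHom_eq_zero_of_not_isUnit {p k : ℕ} [Fact p.Prime] (hk : k ≠ 0) {a : ZMod (p ^ k)}
    (ha : ¬ IsUnit a) : ZMod.castHom (dvd_pow_self p hk) (ZMod p) a = 0 := by
  obtain ⟨a, rfl⟩ := ZMod.natCast_zmod_surjective a
  rw [ZMod.isUnit_iff_coprime, Nat.coprime_pow_right_iff (Nat.pos_of_ne_zero hk), Nat.coprime_comm,
    (Fact.out : p.Prime).coprime_iff_not_dvd, not_not] at ha
  rwa [map_natCast, ZMod.natCast_eq_zero_iff]

theorem not_isCoprime_iff {p k : ℕ} [Fact p.Prime] (hk : k ≠ 0) {a b : ZMod (p ^ k)} :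
    ¬ IsCoprime a b ↔ ¬ IsUnit a ∧ ¬ IsUnit b := by
  refine ⟨fun h ↦ ⟨fun h' ↦ h ?_, fun h' ↦ h ?_⟩, fun h h' ↦ ?_⟩
  · obtain ⟨c, hc⟩ := isUnit_iff_exists_inv'.1 h'
    exact ⟨c, 0, by simp [hc]⟩
  · obtain ⟨c, hc⟩ := isUnit_iff_exists_inv'.1 h'
    exact ⟨0, c, by simp [hc]⟩
  have := h'.map (ZMod.castHom (dvd_pow_self p hk) (ZMod p))
  rw [castHom_eq_zero_of_not_isUnit hk h.1, castHom_eq_zero_of_not_isUnit hk h.2] at this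
  simp at this

theorem natCard_coprimePair_prime_pow {p k : ℕ} [Fact p.Prime] (hk : k ≠ 0) :
    Nat.card (CoprimePair (ZMod (p ^ k))) + (p ^ (k - 1)) ^ 2 = (p ^ k) ^ 2 := by
  classical
  have h₁ : Nat.card {d : ZMod (p ^ k) // ¬ IsUnit d} = p ^ (k - 1) := by
    have h := Nat.card_congr (Equiv.sumCompl fun d : ZMod (p ^ k) ↦ IsUnit d)
    rw [Nat.card_sum, natCard_isUnit, Nat.card_zmod,
      Nat.totient_prime_pow Fact.out (Nat.pos_of_ne_zero hk)] at h
    obtain ⟨q, rfl⟩ : ∃ q, p = q + 1 := Nat.exists_eq_succ_of_ne_zero (Fact.out : p.Prime).ne_zero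
    obtain ⟨k, rfl⟩ := Nat.exists_eq_succ_of_ne_zero hk
    simp only [Nat.succ_eq_add_one, add_tsub_cancel_right, pow_succ] at h ⊢
    lia
  have h₂ : Nat.card {x : ZMod (p ^ k) × ZMod (p ^ k) // ¬ IsCoprime x.1 x.2} =
      (p ^ (k - 1)) ^ 2 := by
    rw [pow_two, ← h₁, ← Nat.card_prod, ← Nat.card_congr Equiv.subtypeProdEquivProd]
    exact Nat.card_congr (Equiv.subtypeEquivRight fun x ↦ not_isCoprime_iff hk)
  have h := Nat.card_congr
    (Equiv.sumCompl fun x : ZMod (p ^ k) × ZMod (p ^ k) ↦ IsCoprime x.1 x.2)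
  rwa [Nat.card_sum, h₂, Nat.card_prod, Nat.card_zmod, ← pow_two] at h

theorem natCard_coprimePair {n : ℕ} (hn : n ≠ 0) :
    (Nat.card (CoprimePair (ZMod n)) : ℚ) =
      n ^ 2 * ∏ p ∈ n.primeFactors, (1 - (1 / (p : ℚ)) ^ 2) := by
  induction n using Nat.recOnPosPrimePosCoprime with
  | zero => exact absurd rfl hn
  | one =>
    have : Unique (CoprimePair (ZMod 1)) :=
      ⟨⟨⟨0, 0, 0, Subsingleton.elim _ _⟩⟩, fun _ ↦ Subsingleton.elim _ _⟩
    simp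
  | prime_pow p k hp hk =>
    have : Fact p.Prime := ⟨hp⟩
    have h := natCard_coprimePair_prime_pow (p := p) hk.ne'
    rw [Nat.primeFactors_prime_pow hk.ne' hp, Finset.prod_singleton]
    have hp0 : (p : ℚ) ≠ 0 := Nat.cast_ne_zero.2 hp.ne_zero
    obtain ⟨k, rfl⟩ := Nat.exists_eq_succ_of_ne_zero hk.ne'
    replace h := congrArg (Nat.cast (R := ℚ)) h
    push_cast [Nat.succ_eq_add_one, add_tsub_cancel_right] at h ⊢
    field_simp
    linear_combination p ^ 2 * h
  | coprime a b ha hb hab iha ihb =>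
    rw [natCard_coprimePair_congr (ZMod.chineseRemainder hab), natCard_coprimePair_prod,
      hab.primeFactors_mul, Finset.prod_union hab.disjoint_primeFactors]
    push_cast
    rw [iha (by lia), ihb (by lia)]
    ring

end CoprimePair

section Involution

variable {M : ℕ}

theorem add_self_eq_zero_iff (hM : M ≠ 0) (a : ZMod (2 * M)) : a + a = 0 ↔ a = 0 ∨ a = (M : ℕ) := by
  have : NeZero (2 * M) := ⟨by lia⟩
  rw [← neg_eq_iff_add_eq_zero, ZMod.neg_eq_self_iff]
  refine or_congr_right ⟨fun h ↦ ?_, fun h ↦ ?_⟩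
  · rw [← ZMod.natCast_zmod_val a]
    congr 1
    lia
  · rw [h, ZMod.val_natCast_of_lt (by lia)]

theorem isCoprime_natCast_iff {m n : ℕ} (hmn : m ∣ n) {k : ℕ} :
    IsCoprime (m : ZMod n) k ↔ m.Coprime k := by
  refine ⟨fun h ↦ ?_, fun h ↦ ?_⟩
  · have := h.map (ZMod.castHom hmn (ZMod m))
    rw [map_natCast, map_natCast, ZMod.natCast_self, isCoprime_zero_left,
      ZMod.isUnit_iff_coprime] at this
    exact this.symm
  · simpa using (Nat.isCoprime_iff_coprime.2 h).map (Int.castRingHom (ZMod n))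

theorem natCard_isCoprime (hM : M ≠ 0) :
    Nat.card {d : ZMod (2 * M) // IsCoprime ((M : ℕ) : ZMod (2 * M)) d} = 2 * M.totient := by
  classical
  have : NeZero (2 * M) := ⟨by lia⟩
  have h : Nat.card {d : ZMod (2 * M) // IsCoprime ((M : ℕ) : ZMod (2 * M)) d} =
      (Finset.filter M.Coprime (Finset.range (2 * M))).card := by
    rw [Nat.card_eq_fintype_card, Fintype.card_subtype]
    refine Finset.card_nbij' ZMod.val Nat.cast (fun d hd ↦ ?_) (fun k hk ↦ ?_)
      (fun d _ ↦ ZMod.natCast_zmod_val d) fun k hk ↦ ?_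
    · simp only [Finset.coe_filter, Set.mem_ofPred_eq, Finset.mem_univ, true_and,
        Finset.mem_range] at hd ⊢
      exact ⟨ZMod.val_lt d, by
        rwa [← ZMod.natCast_zmod_val d, isCoprime_natCast_iff (dvd_mul_left M 2)] at hd⟩
    · simp only [Finset.coe_filter, Set.mem_ofPred_eq, Finset.mem_univ, true_and,
        Finset.mem_range] at hk ⊢
      exact (isCoprime_natCast_iff (dvd_mul_left M 2)).2 hk.2
    · simp only [Finset.coe_filter, Set.mem_ofPred_eq, Finset.mem_range] at hk
      exact ZMod.val_natCast_of_lt hk.1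
  rw [h, Finset.range_eq_Ico, ← Finset.Ico_union_Ico_eq_Ico (Nat.zero_le M) (by lia : M ≤ 2 * M),
    Finset.filter_union, Finset.card_union_of_disjoint]
  · have h₁ := Nat.filter_coprime_Ico_eq_totient M 0
    have h₂ := Nat.filter_coprime_Ico_eq_totient M M
    rw [zero_add] at h₁
    rw [← two_mul] at h₂
    rw [h₁, h₂, two_mul]
  · exact Finset.disjoint_filter_filter (Finset.Ico_disjoint_Ico_consecutive 0 M (2 * M))

theorem natCard_coprimePair_involution (hM : M ≠ 0) :
    Nat.card {x : CoprimePair (ZMod (2 * M)) // x.1.1 + x.1.1 = 0} =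
      (2 * M).totient + 2 * M.totient := by
  have : NeZero (2 * M) := ⟨by lia⟩
  have hM' : ((M : ℕ) : ZMod (2 * M)) ≠ 0 := fun h ↦ by
    rw [ZMod.natCast_eq_zero_iff] at h
    exact absurd (Nat.le_of_dvd (Nat.pos_of_ne_zero hM) h) (by lia)
  let e : {d : ZMod (2 * M) // IsUnit d} ⊕
      {d : ZMod (2 * M) // IsCoprime ((M : ℕ) : ZMod (2 * M)) d} →
      {x : CoprimePair (ZMod (2 * M)) // x.1.1 + x.1.1 = 0} :=
    Sum.elim (fun d ↦ ⟨⟨(0, d.1), isCoprime_zero_left.2 d.2⟩, add_zero 0⟩)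
      fun d ↦ ⟨⟨(M, d.1), d.2⟩, (add_self_eq_zero_iff hM _).2 (.inr rfl)⟩
  have he : Function.Bijective e := by
    constructor
    · rintro (a | a) (b | b) h <;> replace h := congrArg (fun z ↦ z.1.1) h <;>
        obtain ⟨h₁, h₂⟩ := Prod.ext_iff.1 h
      · exact congrArg Sum.inl (Subtype.ext h₂)
      · exact absurd h₁.symm hM'
      · exact absurd h₁ hM'
      · exact congrArg Sum.inr (Subtype.ext h₂)
    · rintro ⟨⟨⟨b, d⟩, h⟩, hb⟩
      rcases (add_self_eq_zero_iff hM b).1 hb with rfl | rfl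
      · exact ⟨.inl ⟨d, isCoprime_zero_left.1 h⟩, rfl⟩
      · exact ⟨.inr ⟨d, h⟩, rfl⟩
  rw [← Nat.card_congr (Equiv.ofBijective e he), Nat.card_sum, natCard_isUnit,
    natCard_isCoprime hM]

end Involution

end KPT

namespace KPT

open Gen TensorProduct

variable {M : ℕ}

variable (M) in
/-- Reduction modulo two. -/
abbrev parity : ZMod (2 * M) →+* ZMod 2 := ZMod.castHom (dvd_mul_right 2 M) (ZMod 2)

theorem zmod_two_eq_one {a : ZMod 2} (h : a ≠ 0) : a = 1 := by
  revert a
  decide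

theorem closure_eq_top_of_isCoprime {u v : ZMod 2 × ZMod (2 * M)} (h : IsCoprime u.2 v.2)
    (hd : u.1 * parity M v.2 + parity M u.2 * v.1 = 1) : AddSubgroup.closure {u, v} = ⊤ := by
  refine eq_top_iff.2 fun w _ ↦ AddSubgroup.mem_closure_pair.2 ?_
  obtain ⟨r, s, hrs⟩ := h
  obtain ⟨t, ht⟩ := ZMod.intCast_surjective
    (w.1 - parity M w.2 * (parity M r * u.1 + parity M s * v.1))
  obtain ⟨m, hm⟩ := ZMod.intCast_surjective (w.2 * r + (t : ZMod (2 * M)) * v.2)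
  obtain ⟨n, hn⟩ := ZMod.intCast_surjective (w.2 * s - (t : ZMod (2 * M)) * u.2)
  have hm' := congrArg (parity M) hm
  have hn' := congrArg (parity M) hn
  simp only [map_intCast, map_add, map_sub, map_mul] at hm' hn'
  refine ⟨m, n, Prod.ext ?_ ?_⟩
  · rw [Prod.fst_add, zsmul_fst_eq_mul, zsmul_fst_eq_mul, hm', hn', ht, CharTwo.sub_eq_add,
      CharTwo.sub_eq_add]
    linear_combination (w.1 + parity M w.2 * (parity M r * u.1 + parity M s * v.1)) * hd +
      CharTwo.add_self_eq_zero (parity M w.2 * (parity M r * u.1 + parity M s * v.1))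
  · rw [Prod.snd_add, zsmul_snd_eq_mul, zsmul_snd_eq_mul, hm, hn]
    linear_combination w.2 * hrs

theorem Gen.isCoprime (x : Gen (ZMod 2 × ZMod (2 * M))) : IsCoprime x.fst.2 x.snd.2 := by
  obtain ⟨m, n, h⟩ := x.exists_combination (0, 1)
  refine ⟨m, n, ?_⟩
  simpa only [Prod.snd_add, zsmul_snd_eq_mul] using congrArg Prod.snd h

theorem Gen.det_eq_one (x : Gen (ZMod 2 × ZMod (2 * M))) :
    x.fst.1 * parity M x.snd.2 + parity M x.fst.2 * x.snd.1 = 1 := by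
  refine zmod_two_eq_one fun h ↦ one_ne_zero (α := ZMod 2) ?_
  rw [← CharTwo.sub_eq_add] at h
  obtain ⟨m, n, h₁⟩ := x.exists_combination (1, 0)
  obtain ⟨m', n', h₂⟩ := x.exists_combination (0, 1)
  have h₁' := congrArg Prod.fst h₁
  have h₂' := congrArg Prod.fst h₂
  have h₁'' := congrArg (fun z ↦ parity M z.2) h₁
  have h₂'' := congrArg (fun z ↦ parity M z.2) h₂
  simp only [Prod.fst_add, zsmul_fst_eq_mul, Prod.snd_add, zsmul_snd_eq_mul, map_add, map_mul,
    map_intCast, map_one, map_zero] at h₁' h₂' h₁'' h₂''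
  linear_combination (-1 : ZMod 2) * h₂'' -
    (m' * parity M x.fst.2 + n' * parity M x.snd.2 : ZMod 2) * h₁' +
    (m' * x.fst.1 + n' * x.snd.1 : ZMod 2) * h₁'' + (m * n' - n * m' : ZMod 2) * h

theorem nondegenerate_two (hM : 2 ≤ M) : Nondegenerate (ZMod 2 × ZMod (2 * M)) := by
  refine fun x ↦ ⟨fun k h ↦ one_ne_zero (α := ZMod 2) ?_, fun h ↦ ?_⟩
  · rw [← x.det_eq_one, h, zsmul_fst_eq_mul, zsmul_snd_eq_mul, map_mul, map_intCast]
    linear_combination CharTwo.add_self_eq_zero (x.fst.1 * (k * parity M x.fst.2))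
  · obtain ⟨r, s, hrs⟩ := x.isCoprime
    have h₁ := congrArg Prod.snd h.1
    have h₂ := congrArg Prod.snd h.2
    simp only [Prod.snd_add, Prod.snd_zero] at h₁ h₂
    have : ((2 : ℕ) : ZMod (2 * M)) = 0 := by
      push_cast
      linear_combination r * h₁ + s * h₂ - 2 * hrs
    rw [ZMod.natCast_eq_zero_iff] at this
    exact absurd (Nat.le_of_dvd two_pos this) (by lia)

theorem IsConnection.exists_snd_eq_zero
    {R : Gen (ZMod 2 × ZMod (2 * M)) → Gen (ZMod 2 × ZMod (2 * M)) → Prop}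
    (hR : IsConnection R) [NeZero (2 * M)] (x : Gen (ZMod 2 × ZMod (2 * M))) :
    ∃ z, R x z ∧ z.snd.2 = 0 := by
  induction h : x.snd.2.val using Nat.strong_induction_on generalizing x with
  | _ v ih =>
    rcases v.eq_zero_or_pos with rfl | hv
    · exact ⟨x, hR.refl x, (ZMod.val_eq_zero _).1 h⟩
    let y := (x.addFst (-(x.fst.2.val / v : ℕ))).swap
    have hy : y.snd.2 = (x.fst.2.val % v : ℕ) := by
      have h₁ : ((x.fst.2.val % v : ℕ) : ZMod (2 * M)) + v * (x.fst.2.val / v : ℕ) = x.fst.2 := by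
        rw [← Nat.cast_mul, ← Nat.cast_add, Nat.mod_add_div, ZMod.natCast_zmod_val]
      have h₂ : (v : ZMod (2 * M)) = x.snd.2 := by rw [← h, ZMod.natCast_zmod_val]
      simp only [y, snd_swap, fst_addFst, Prod.snd_add, zsmul_snd_eq_mul]
      rw [Int.cast_neg, Int.cast_natCast]
      linear_combination -h₁ + ((x.fst.2.val / v : ℕ) : ZMod (2 * M)) * h₂
    have hlt : x.fst.2.val % v < v := Nat.mod_lt _ hv
    have hval : y.snd.2.val = x.fst.2.val % v := by
      rw [hy, ZMod.val_natCast_of_lt (hlt.trans (h ▸ ZMod.val_lt _))]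
    obtain ⟨z, hz, hz'⟩ := ih _ hlt y hval
    exact ⟨z, hR.trans (hR.trans (hR.addFst _ x) (hR.swap _)) hz, hz'⟩

theorem IsConnection.rel_all
    {R : Gen (ZMod 2 × ZMod (2 * M)) → Gen (ZMod 2 × ZMod (2 * M)) → Prop}
    (hR : IsConnection R) [NeZero (2 * M)] (x y : Gen (ZMod 2 × ZMod (2 * M))) : R x y := by
  have key (x : Gen (ZMod 2 × ZMod (2 * M))) :
      ∃ z, R x z ∧ z.fst = (0, 1) ∧ z.snd = (1, 0) := by
    obtain ⟨x₁, hx₁, h₁⟩ := hR.exists_snd_eq_zero x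
    have hd := x₁.det_eq_one
    rw [h₁, map_zero, mul_zero, zero_add] at hd
    have hv : x₁.snd.1 = 1 := zmod_two_eq_one (right_ne_zero_of_mul (hd ▸ one_ne_zero))
    have hw : parity M x₁.fst.2 = 1 := zmod_two_eq_one (left_ne_zero_of_mul (hd ▸ one_ne_zero))
    obtain ⟨i, hi⟩ := ZMod.intCast_surjective (-x₁.fst.1)
    obtain ⟨k, l, hkl⟩ := x₁.isCoprime
    obtain ⟨j, hj⟩ := ZMod.intCast_surjective k
    obtain ⟨m, hm⟩ := ZMod.intCast_surjective (1 - x₁.fst.2)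
    have hm' := congrArg (parity M) hm
    rw [map_intCast, map_sub, map_one, hw, sub_self] at hm'
    rw [h₁, mul_zero, add_zero] at hkl
    refine ⟨(((x₁.addFst i).addSnd j).addFst m).addSnd (-1), hR.trans hx₁ (hR.trans
      (hR.addFst i _) (hR.trans (hR.addSnd j _) (hR.trans (hR.addFst m _) (hR.addSnd (-1) _)))),
      Prod.ext ?_ ?_, Prod.ext ?_ ?_⟩
    all_goals
      simp only [fst_addFst, snd_addFst, fst_addSnd, snd_addSnd, Prod.fst_add, Prod.snd_add,
        zsmul_fst_eq_mul, zsmul_snd_eq_mul, hm', hm, hj, hi, hv, h₁, Int.cast_neg, Int.cast_one]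
    · ring
    · linear_combination (1 - x₁.fst.2) * hkl
    · ring
    · linear_combination x₁.fst.2 * hkl
  obtain ⟨z, hz, hz₁, hz₂⟩ := key x
  obtain ⟨w, hw, hw₁, hw₂⟩ := key y
  exact hR.trans hz ((Gen.ext (hz₁.trans hw₁.symm) (hz₂.trans hw₂.symm) : z = w) ▸ hR.symm hw)

theorem isComponentMap_unit [NeZero (2 * M)] :
    IsComponentMap fun _ : Gen (ZMod 2 × ZMod (2 * M)) ↦ () := by
  refine ⟨fun _ ↦ ⟨⟨((0, 1), (1, 0)), closure_eq_top_of_isCoprime ?_ ?_⟩, rfl⟩, fun _ ↦ rfl,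
    fun _ ↦ rfl, fun _ ↦ rfl, fun R h hs hr hf x y _ ↦ ?_⟩
  · exact isCoprime_one_left
  · simp
  · exact IsConnection.rel_all ⟨h, hs, hr, hf⟩ x y

variable (M) in
/-- A generating pair amounts to a pair of coprime second entries and a bit. -/
noncomputable def genEquiv : Gen (ZMod 2 × ZMod (2 * M)) ≃ CoprimePair (ZMod (2 * M)) × ZMod 2 where
  toFun x := (⟨(x.fst.2, x.snd.2), x.isCoprime⟩,
    parity M x.isCoprime.choose * x.fst.1 + parity M x.isCoprime.choose_spec.choose * x.snd.1)
  invFun y := ⟨((parity M y.1.2.choose_spec.choose + y.2 * parity M y.1.1.1, y.1.1.1),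
      (parity M y.1.2.choose + y.2 * parity M y.1.1.2, y.1.1.2)), by
    have h := congrArg (parity M) y.1.2.choose_spec.choose_spec
    simp only [map_add, map_mul, map_one] at h
    refine closure_eq_top_of_isCoprime y.1.2 ?_
    linear_combination h + CharTwo.add_self_eq_zero (y.2 * parity M y.1.1.1 * parity M y.1.1.2)⟩
  left_inv x := by
    have h := congrArg (parity M) x.isCoprime.choose_spec.choose_spec
    have hd := x.det_eq_one
    simp only [map_add, map_mul, map_one] at h
    refine Gen.ext (Prod.ext ?_ rfl) (Prod.ext ?_ rfl)
    · change parity M x.isCoprime.choose_spec.choose +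
        (parity M x.isCoprime.choose * x.fst.1 +
          parity M x.isCoprime.choose_spec.choose * x.snd.1) * parity M x.fst.2 = x.fst.1
      generalize parity M x.isCoprime.choose = r at *
      generalize parity M x.isCoprime.choose_spec.choose = s at *
      generalize parity M x.fst.2 = b at *
      generalize parity M x.snd.2 = d at *
      generalize x.fst.1 = a at *
      generalize x.snd.1 = c at *
      revert r s a b c d
      decide
    · change parity M x.isCoprime.choose +
        (parity M x.isCoprime.choose * x.fst.1 +
          parity M x.isCoprime.choose_spec.choose * x.snd.1) * parity M x.snd.2 = x.snd.1
      generalize parity M x.isCoprime.choose = r at *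
      generalize parity M x.isCoprime.choose_spec.choose = s at *
      generalize parity M x.fst.2 = b at *
      generalize parity M x.snd.2 = d at *
      generalize x.fst.1 = a at *
      generalize x.snd.1 = c at *
      revert r s a b c d
      decide
  right_inv y := by
    have h := congrArg (parity M) y.1.2.choose_spec.choose_spec
    simp only [map_add, map_mul, map_one] at h
    refine Prod.ext rfl ?_
    change parity M y.1.2.choose * (parity M y.1.2.choose_spec.choose + y.2 * parity M y.1.1.1) +
      parity M y.1.2.choose_spec.choose * (parity M y.1.2.choose + y.2 * parity M y.1.1.2) = y.2
    linear_combination y.2 * h +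
      CharTwo.add_self_eq_zero (parity M y.1.2.choose * parity M y.1.2.choose_spec.choose)

theorem natCard_gen_two : Nat.card (Gen (ZMod 2 × ZMod (2 * M))) =
    2 * Nat.card (CoprimePair (ZMod (2 * M))) := by
  rw [Nat.card_congr (genEquiv M), Nat.card_prod, Nat.card_zmod, mul_comm]

theorem natCard_gen_two_involution (hM : M ≠ 0) :
    Nat.card {x : Gen (ZMod 2 × ZMod (2 * M)) // x.fst + x.fst = 0} =
      2 * ((2 * M).totient + 2 * M.totient) := by
  rw [← natCard_coprimePair_involution hM]
  have h (x : Gen (ZMod 2 × ZMod (2 * M))) :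
      x.fst + x.fst = 0 ↔ (genEquiv M x).1.1.1 + (genEquiv M x).1.1.1 = 0 :=
    ⟨fun h ↦ congrArg Prod.snd h, fun h ↦ Prod.ext (CharTwo.add_self_eq_zero _) h⟩
  rw [Nat.card_congr (((genEquiv M).subtypeEquiv (q := fun y ↦ y.1.1.1 + y.1.1.1 = 0) h).trans
    (Equiv.prodSubtypeFstEquivSubtypeProd (β := ZMod 2)
      (p := fun z : CoprimePair (ZMod (2 * M)) ↦ z.1.1 + z.1.1 = 0))), Nat.card_prod, Nat.card_zmod,
    mul_comm]

end KPT

open KPT TensorProduct in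
theorem statement_19 :
    (∀ M : ℕ, 3 ≤ M →
      (Module.finrank ℚ (ℚ ⊗[ℤ] MnMinus 2 (ZMod 2 × ZMod (2*M))) : ℚ)
          = 1 - (M.totient : ℚ) - ((2*M).totient : ℚ)/2
            + ((M:ℚ)^2/3) * ∏ p ∈ (2*M).primeFactors, (1 - (1/(p:ℚ))^2) ∧
      Nonempty (AddCommGroup.torsion (MnMinus 2 (ZMod 2 × ZMod (2*M)))
          ≃+ (Fin (2 * M.totient + (2*M).totient - 1) → ZMod 2))) ∧
    (∀ p : ℕ, p.Prime → Odd p →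
      (Module.finrank ℚ (ℚ ⊗[ℤ] Mn 2 (ZMod p × ZMod p)) : ℚ)
          = ((p:ℚ) - 1) * ((p:ℚ)^3 + 6*(p:ℚ)^2 - (p:ℚ) + 6) / 24 ∧
      (Module.finrank ℚ (ℚ ⊗[ℤ] MnMinus 2 (ZMod p × ZMod p)) : ℚ)
          = ((p:ℚ) - 1) * ((p:ℚ)^3 - (p:ℚ) + 12) / 24 ∧
      (Module.finrank ℚ (ℚ ⊗[ℤ] Mn 2 (ZMod p × ZMod p)) : ℚ)
          - (Module.finrank ℚ (ℚ ⊗[ℤ] MnMinus 2 (ZMod p × ZMod p)) : ℚ)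
          = ((p:ℚ) + 1) * ((p:ℚ) - 1)^2 / 4) := by
  refine ⟨fun M hM ↦ ?_, fun p hp hodd ↦ ?_⟩
  · have : NeZero (2 * M) := ⟨by lia⟩
    have hZ := natCard_gen_two_involution (M := M) (by lia)
    have hφ := Nat.totient_pos.2 (by lia : 0 < M)
    constructor
    · have h := (nondegenerate_two (by lia : 2 ≤ M)).finrank_MnMinus isComponentMap_unit
      rw [hZ, natCard_gen_two, Nat.card_unique (α := Unit)] at h
      replace h := congrArg (Nat.cast (R := ℚ)) h
      push_cast [natCard_coprimePair this.out] at h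
      linear_combination h / 24
    · have hx : ∃ x : Gen (ZMod 2 × ZMod (2 * M)), x.fst + x.fst = 0 := by
        by_contra! hne
        have : IsEmpty {x : Gen (ZMod 2 × ZMod (2 * M)) // x.fst + x.fst = 0} :=
          ⟨fun x ↦ hne x.1 x.2⟩
        rw [Nat.card_of_isEmpty] at hZ
        lia
      obtain ⟨x, hx⟩ := hx
      exact (nondegenerate_two (by lia)).torsion_MnMinus isComponentMap_unit (fun _ _ ↦ rfl) hx
        (by rw [hZ]; lia)
  · have : Fact p.Prime := ⟨hp⟩
    obtain ⟨h₁, h₂⟩ := finrank_zmod_prod hodd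
    have hp₁ : p ≤ p ^ 2 := Nat.le_self_pow two_ne_zero p
    have hp₂ : 1 ≤ p := hp.one_le
    replace h₁ := congrArg (Nat.cast (R := ℚ)) h₁
    replace h₂ := congrArg (Nat.cast (R := ℚ)) h₂
    push_cast [Nat.cast_sub hp₁, Nat.cast_sub hp₂, Nat.cast_sub (hp₂.trans hp₁)] at h₁ h₂
    refine ⟨?_, ?_, ?_⟩
    · linear_combination h₂ / 4 + h₁ / 24
    · linear_combination h₁ / 24
    · linear_combination h₂ / 4
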